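/- arXiv:1902.06318 — 5 statements merged into one kernel-verified Lean document; each statement's English description precedes it below -/
import Mathlib

section
/- Let A be a linearly ordered set. The transitive closure ≺ of the relation ≺′ on finite subsets of A is irreflexive (there is no finite subset I with I ≺ I); consequently ≺ is a strict partial order on the collection of finite subsets of A, i.e. the relation ≺′ admits no cycles. -/
/-!
For finite subsets `I, J` of a linearly ordered set `A`, let `∂(J)` (`delMax J`) denote `J`
with its maximal element removed.  Define `I ≺′ J` (`precStep I J`) to hold if either
`J = I ∖ {a}` for some `a ∈ I` with `a ≠ max I`, or `J ≠ ∅` and `I = ∂(J)`.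
Let `≺` (`prec`) be the transitive closure of `≺′`.

STATEMENT: `≺` is irreflexive (there is no finite subset `I` with `I ≺ I`); consequently
`≺` is a strict partial order on the collection of finite subsets of `A`, i.e. `≺′`
admits no cycles.
-/

variable {A : Type*} [LinearOrder A] [DecidableEq A]

/-- `S` with its maximal element removed (`∅` if `S = ∅`). -/
def delMax (S : Finset A) : Finset A :=
  if h : S.Nonempty then S.erase (S.max' h) else ∅

/-- The relation `≺′`. -/
def precStep (I J : Finset A) : Prop :=
  (∃ a ∈ I, (a : WithBot A) ≠ I.max ∧ J = I.erase a) ∨ (J.Nonempty ∧ I = delMax J)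

/-- The relation `≺`, the transitive closure of `≺′`. -/
def prec : Finset A → Finset A → Prop :=
  Relation.TransGen precStep

theorem max_erase_of_ne_max {I : Finset A} {a : A} (h : (a : WithBot A) ≠ I.max) :
    (I.erase a).max = I.max := by
  refine le_antisymm (Finset.max_mono (Finset.erase_subset a I)) (Finset.sup_le fun b hb => ?_)
  by_cases hba : b = a
  · subst hba
    obtain ⟨m, hm⟩ := Finset.max_of_mem hb
    have hmI : m ∈ I.erase b :=
      Finset.mem_erase.2 ⟨fun hmb => h (by rw [hm, hmb]), Finset.mem_of_max hm⟩
    calc (b : WithBot A) ≤ I.max := Finset.le_max hb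
      _ = m := hm
      _ ≤ (I.erase b).max := Finset.le_max hmI
  · exact Finset.le_max (Finset.mem_erase.2 ⟨hba, hb⟩)

theorem max_delMax_lt {J : Finset A} (hJ : J.Nonempty) : (delMax J).max < J.max := by
  rw [delMax, dif_pos hJ, ← Finset.coe_max' hJ]
  refine (Finset.sup_lt_iff (WithBot.bot_lt_coe _)).2 fun b hb => ?_
  exact WithBot.coe_lt_coe.2 (Finset.lt_max'_of_mem_erase_max' J hJ hb)

/-- The pair of the maximum and the cardinality, ordered lexicographically with the order on
cardinalities reversed; it strictly increases along `precStep`. -/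
def precRank (I : Finset A) : WithBot A ×ₗ ℕᵒᵈ :=
  toLex (I.max, OrderDual.toDual I.card)

theorem precRank_lt_of_precStep {I J : Finset A} (h : precStep I J) :
    precRank I < precRank J := by
  rw [precRank, precRank, Prod.Lex.toLex_lt_toLex]
  rcases h with ⟨a, ha, hne, rfl⟩ | ⟨hJ, rfl⟩
  · exact Or.inr ⟨(max_erase_of_ne_max hne).symm,
      OrderDual.toDual_lt_toDual.2 (Finset.card_erase_lt_of_mem ha)⟩
  · exact Or.inl (max_delMax_lt hJ)

theorem precRank_lt_of_prec {I J : Finset A} (h : prec I J) : precRank I < precRank J := by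
  induction h with
  | single h => exact precRank_lt_of_precStep h
  | tail _ h ih => exact ih.trans (precRank_lt_of_precStep h)

theorem prec_irrefl (I : Finset A) : ¬ prec I I := by
  exact fun h => lt_irrefl _ (precRank_lt_of_prec h)
end

section
/- Let S be a finite subset of ℕ with |S| ≥ 3, and let T₁, T₂ be distinct finite subsets of ℕ with |T₁|, |T₂| ≥ 3 such that {T₁, T₂} is a normal pair and, for each i ∈ {1,2}, either Tᵢ ∩ S = ∅ or Tᵢ is an essential MI-complement of S. Define f(T) = T ∖ (S ∖ {min S}). Then |f(T₁)| ≥ 3, |f(T₂)| ≥ 3, and {f(T₁), f(T₂)} is again a normal pair (in particular f(T₁) ≠ f(T₂)). -/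
/-!
A nonempty finite `U ⊆ ℕ` is an initial interval of a finite `I ⊆ ℕ` if `U ⊆ I` and every
element of `I` that is `≤ max U` belongs to `U`.  For finite `S, T ⊆ ℕ` with `|S|, |T| ≥ 3`,
`T` is an MI-complement of `S` if `S ∩ T ≠ ∅`, `T` is an initial interval of `S ∪ T`, and
there is no initial interval `U` of `S ∪ T` with `|U| ≥ 3`, `S ∩ U ≠ ∅`, `S ∪ U = S ∪ T`
and `|U| < |T|`; it is essential if moreover `|T ∖ S| > 1`.  A pair `{S, T}` is normal if
`max S ≠ max T` and one of: `S ∩ T = ∅`; `S ⊆ T`; `T ⊆ S`; `T` is an essential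
MI-complement of `S`; `S` is an essential MI-complement of `T`.

STATEMENT: let `|S| ≥ 3` and let `T₁ ≠ T₂` with `|Tᵢ| ≥ 3` form a normal pair such that
each `Tᵢ` is either disjoint from `S` or an essential MI-complement of `S`.  With
`f(T) = T ∖ (S ∖ {min S})`, one has `|f(T₁)| ≥ 3`, `|f(T₂)| ≥ 3`, and `{f(T₁), f(T₂)}` is
again a normal pair (in particular `f(T₁) ≠ f(T₂)`).
-/

/-- A nonempty `U` is an initial interval of `I` if `U ⊆ I` and every element of `I`
that is `≤ max U` belongs to `U`. -/
def IsInitialInterval (U I : Finset ℕ) : Prop :=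
  U.Nonempty ∧ U ⊆ I ∧ ∀ x ∈ I, (x : WithBot ℕ) ≤ U.max → x ∈ U

/-- `T` is an MI-complement (minimal interval complement) of `S`. -/
def IsMIComplement (T S : Finset ℕ) : Prop :=
  3 ≤ S.card ∧ 3 ≤ T.card ∧ (S ∩ T).Nonempty ∧ IsInitialInterval T (S ∪ T) ∧
    ∀ U : Finset ℕ, IsInitialInterval U (S ∪ T) → 3 ≤ U.card → (S ∩ U).Nonempty →
      S ∪ U = S ∪ T → ¬ U.card < T.card

/-- `T` is an essential MI-complement of `S` if it is an MI-complement and `|T ∖ S| > 1`. -/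
def IsEssentialMIComplement (T S : Finset ℕ) : Prop :=
  IsMIComplement T S ∧ 1 < (T \ S).card

/-- `{S, T}` is a normal pair. -/
def NormalPair (S T : Finset ℕ) : Prop :=
  3 ≤ S.card ∧ 3 ≤ T.card ∧ S.max ≠ T.max ∧
    (S ∩ T = ∅ ∨ S ⊆ T ∨ T ⊆ S ∨
      IsEssentialMIComplement T S ∨ IsEssentialMIComplement S T)

theorem Finset.max_eq_coe_iff {T : Finset ℕ} {p : ℕ} :
    T.max = (p : WithBot ℕ) ↔ p ∈ T ∧ ∀ x ∈ T, x ≤ p := by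
  constructor
  · intro h
    exact ⟨Finset.mem_of_max h, fun x hx => Finset.le_max_of_eq hx h⟩
  · rintro ⟨hp, h⟩
    exact le_antisymm (Finset.max_le fun x hx => WithBot.coe_le_coe.2 (h x hx))
      (Finset.le_max hp)

/-- Minimality of an essential MI-complement `T` of `S` means that the maximum of `T` either
lies outside `S` or is the only common element of `S` and `T`. -/
theorem isEssentialMIComplement_iff {S T : Finset ℕ} {p : ℕ} (hp : p ∈ T)
    (hmax : ∀ x ∈ T, x ≤ p) :
    IsEssentialMIComplement T S ↔ 3 ≤ S.card ∧ 3 ≤ T.card ∧ (S ∩ T).Nonempty ∧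
      (∀ x ∈ S, x ≤ p → x ∈ T) ∧ (p ∈ S → ∀ x ∈ S, x ∈ T → x = p) ∧ 1 < (T \ S).card := by
  have hTmax : T.max = (p : WithBot ℕ) := Finset.max_eq_coe_iff.2 ⟨hp, hmax⟩
  constructor
  · rintro ⟨⟨hS, hT, hne, ⟨-, -, hint⟩, hmin⟩, hess⟩
    refine ⟨hS, hT, hne, fun x hx hxp => hint x (Finset.mem_union_left _ hx) ?_, ?_, hess⟩
    · rw [hTmax]
      exact WithBot.coe_le_coe.2 hxp
    intro hpS x hxS hxT
    by_contra hxp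
    have hcard : (T.erase p).card + 1 = T.card := Finset.card_erase_add_one hp
    have hinter : 1 < (T ∩ S).card :=
      Finset.one_lt_card.2 ⟨x, by simp [hxS, hxT], p, by simp [hpS, hp], hxp⟩
    have hsum := Finset.card_sdiff_add_card_inter T S
    refine hmin (T.erase p) ⟨⟨x, by simp [hxT, hxp]⟩, ?_, ?_⟩ (by omega)
      ⟨x, by simp [hxS, hxT, hxp]⟩ ?_ (by omega)
    · exact (Finset.erase_subset _ _).trans Finset.subset_union_right
    · intro y hy hyle
      have hyp : y < p := by
        have : (T.erase p).max < (p : WithBot ℕ) := by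
          refine lt_of_le_of_ne (Finset.max_le fun z hz => ?_) Finset.max_erase_ne_self
          exact WithBot.coe_le_coe.2 (hmax z (Finset.mem_of_mem_erase hz))
        exact WithBot.coe_lt_coe.1 (hyle.trans_lt this)
      refine Finset.mem_erase.2 ⟨hyp.ne, hint y hy ?_⟩
      rw [hTmax]
      exact WithBot.coe_le_coe.2 hyp.le
    · ext y
      simp only [Finset.mem_union, Finset.mem_erase]
      by_cases hy : y = p
      · simp [hy, hpS]
      · simp [hy]
  · rintro ⟨hS, hT, hne, hint, hlast, hess⟩
    refine ⟨⟨hS, hT, hne, ⟨⟨p, hp⟩, Finset.subset_union_right, ?_⟩, ?_⟩, hess⟩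
    · intro x hx hxle
      rw [hTmax] at hxle
      rcases Finset.mem_union.1 hx with h | h
      · exact hint x h (WithBot.coe_le_coe.1 hxle)
      · exact h
    · rintro U ⟨-, hU, hUint⟩ - ⟨z, hz⟩ hunion hlt
      rw [Finset.mem_inter] at hz
      by_cases hpU : p ∈ U
      · refine absurd (Finset.card_le_card fun x hx => ?_) hlt.not_ge
        exact hUint x (Finset.mem_union_right _ hx)
          ((WithBot.coe_le_coe.2 (hmax x hx)).trans (Finset.le_max hpU))
      · have hpS : p ∈ S := by
          have : p ∈ S ∪ U := hunion ▸ Finset.mem_union_right _ hp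
          simpa [hpU] using this
        have hzp : p < z := by
          by_contra hle
          exact hpU (hlast hpS z hz.1 (hint z hz.1 (not_lt.1 hle)) ▸ hz.2)
        exact hpU (hUint p (Finset.mem_union_left _ hpS)
          ((WithBot.coe_le_coe.2 hzp.le).trans (Finset.le_max hz.2)))

/-- A set which is disjoint from `S`, or an essential MI-complement of `S`, keeps its maximum
and at least three elements after removal of all non-minimal elements of `S`. -/
theorem mem_and_card_sdiff_erase {S T : Finset ℕ} {m p : ℕ} (hT : 3 ≤ T.card)
    (h : T ∩ S = ∅ ∨ IsEssentialMIComplement T S) (hm : m ∈ S) (hmin : ∀ x ∈ S, m ≤ x)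
    (hp : p ∈ T) (hmax : ∀ x ∈ T, x ≤ p) :
    p ∈ T \ S.erase m ∧ 3 ≤ (T \ S.erase m).card := by
  rcases h with h | h
  · have hdisj : Disjoint T S := Finset.disjoint_iff_inter_eq_empty.2 h
    rw [Finset.sdiff_eq_self_of_disjoint (hdisj.mono_right (Finset.erase_subset _ _))]
    exact ⟨hp, hT⟩
  · obtain ⟨-, -, ⟨z, hz⟩, hint, hlast, hess⟩ := (isEssentialMIComplement_iff hp hmax).1 h
    rw [Finset.mem_inter] at hz
    have hmT : m ∈ T := hint m hm ((hmin z hz.1).trans (hmax z hz.2))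
    constructor
    · simp only [Finset.mem_sdiff, Finset.mem_erase, hp, true_and, not_and]
      exact fun hpm hpS => hpm (hlast hpS m hm hmT).symm
    · have hsub : insert m (T \ S) ⊆ T \ S.erase m := by
        intro x hx
        simp only [Finset.mem_insert, Finset.mem_sdiff, Finset.mem_erase] at hx ⊢
        rcases hx with rfl | hx
        · exact ⟨hmT, fun h => h.1 rfl⟩
        · exact ⟨hx.1, fun h => hx.2 h.2⟩
      have hcard := Finset.card_le_card hsub
      rw [Finset.card_insert_of_notMem (by simp [hm])] at hcard
      omega

/-- Removal of all non-minimal elements of `S` from an essential MI-complement `T₂` of `T₁`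
and from `T₁` leaves an essential MI-complement, unless the results are disjoint or nested. -/
theorem IsEssentialMIComplement.sdiff_erase {S T₁ T₂ : Finset ℕ} {m : ℕ}
    (h : IsEssentialMIComplement T₂ T₁) (hmax_ne : T₁.max ≠ T₂.max)
    (h₁ : T₁ ∩ S = ∅ ∨ IsEssentialMIComplement T₁ S)
    (h₂ : T₂ ∩ S = ∅ ∨ IsEssentialMIComplement T₂ S)
    (hm : m ∈ S) (hmin : ∀ x ∈ S, m ≤ x) :
    (T₁ \ S.erase m) ∩ (T₂ \ S.erase m) = ∅ ∨ T₁ \ S.erase m ⊆ T₂ \ S.erase m ∨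
      T₂ \ S.erase m ⊆ T₁ \ S.erase m ∨
      IsEssentialMIComplement (T₂ \ S.erase m) (T₁ \ S.erase m) := by
  have hT₁ : 3 ≤ T₁.card := h.1.1
  have hT₂ : 3 ≤ T₂.card := h.1.2.1
  obtain ⟨p, hTp⟩ := Finset.max_of_nonempty (Finset.card_pos.1 (by omega : 0 < T₁.card))
  obtain ⟨q, hTq⟩ := Finset.max_of_nonempty (Finset.card_pos.1 (by omega : 0 < T₂.card))
  rw [hTp, hTq] at hmax_ne
  have hpq : p ≠ q := fun e => hmax_ne (congrArg _ e)
  obtain ⟨hp, hpmax⟩ := Finset.max_eq_coe_iff.1 hTp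
  obtain ⟨hq, hqmax⟩ := Finset.max_eq_coe_iff.1 hTq
  obtain ⟨-, hcard₁⟩ := mem_and_card_sdiff_erase hT₁ h₁ hm hmin hp hpmax
  obtain ⟨hqf, hcard₂⟩ := mem_and_card_sdiff_erase hT₂ h₂ hm hmin hq hqmax
  obtain ⟨-, -, -, hint, hlast, hess⟩ := (isEssentialMIComplement_iff hq hqmax).1 h
  rcases hpq.lt_or_gt with hlt | hlt
  · exact Or.inr (Or.inl (Finset.sdiff_subset_sdiff
      (fun x hx => hint x hx ((hpmax x hx).trans hlt.le)) subset_rfl))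
  by_cases hdisj : (T₁ \ S.erase m) ∩ (T₂ \ S.erase m) = ∅
  · exact Or.inl hdisj
  by_cases hsub : T₂ \ S.erase m ⊆ T₁ \ S.erase m
  · exact Or.inr (Or.inr (Or.inl hsub))
  refine Or.inr (Or.inr (Or.inr ?_))
  rw [isEssentialMIComplement_iff hqf fun x hx => hqmax x (Finset.mem_sdiff.1 hx).1]
  refine ⟨hcard₁, hcard₂, Finset.nonempty_iff_ne_empty.2 hdisj, ?_, ?_, ?_⟩
  · intro x hx hxq
    rw [Finset.mem_sdiff] at hx ⊢
    exact ⟨hint x hx.1 hxq, hx.2⟩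
  · intro hq₁ x hx₁ hx₂
    exact hlast (Finset.mem_sdiff.1 hq₁).1 x (Finset.mem_sdiff.1 hx₁).1 (Finset.mem_sdiff.1 hx₂).1
  by_contra hle
  have huniq : ∀ x ∈ T₂, x ∉ S.erase m → x ∉ T₁ → ∀ y ∈ T₂, y ∉ S.erase m → y ∉ T₁ → x = y :=
    fun x hx hxS hx₁ y hy hyS hy₁ => Finset.card_le_one.1 (not_lt.1 hle) x
      (by simp only [Finset.mem_sdiff]; tauto) y (by simp only [Finset.mem_sdiff]; tauto)
  obtain ⟨s, hs₂, hs₁, hsm, hsS⟩ : ∃ s ∈ T₂, s ∉ T₁ ∧ s ≠ m ∧ s ∈ S := by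
    obtain ⟨x, hx, y, hy, hxy⟩ := Finset.one_lt_card.1 hess
    rw [Finset.mem_sdiff] at hx hy
    by_contra! hcon
    exact hxy (huniq x hx.1 (fun h => hcon x hx.1 hx.2 (Finset.mem_erase.1 h).1
      (Finset.mem_erase.1 h).2) hx.2 y hy.1 (fun h => hcon y hy.1 hy.2 (Finset.mem_erase.1 h).1
      (Finset.mem_erase.1 h).2) hy.2)
  have hdisj₁ : T₁ ∩ S = ∅ := by
    refine h₁.resolve_right fun h => hs₁ ?_
    exact ((isEssentialMIComplement_iff hp hpmax).1 h).2.2.2.1 s hsS ((hqmax s hs₂).trans hlt.le)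
  have hess₂ : IsEssentialMIComplement T₂ S := by
    refine h₂.resolve_left fun h => ?_
    have : s ∈ T₂ ∩ S := Finset.mem_inter.2 ⟨hs₂, hsS⟩
    simp [h] at this
  obtain ⟨-, -, -, hintS, hlastS, hessS⟩ := (isEssentialMIComplement_iff hq hqmax).1 hess₂
  have hm₂ : m ∈ T₂ := hintS m hm ((hmin s hsS).trans (hqmax s hs₂))
  have hm₁ : m ∉ T₁ := fun h => by
    have : m ∈ T₁ ∩ S := Finset.mem_inter.2 ⟨h, hm⟩
    simp [hdisj₁] at this
  have hsub₁ : ∀ x ∈ T₂, x ∉ S → x ∈ T₁ := by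
    intro x hx hxS
    by_contra hx₁
    refine hxS (huniq x hx (fun h => hxS (Finset.mem_erase.1 h).2) hx₁ m hm₂ (by simp) hm₁ ▸ hm)
  have hqS : q ∉ S := fun h => hsm ((hlastS h s hsS hs₂).trans (hlastS h m hm hm₂).symm)
  have hq₁ : q ∈ T₁ := hsub₁ q hq hqS
  obtain ⟨x, hx, y, hy, hxy⟩ := Finset.one_lt_card.1 hessS
  rw [Finset.mem_sdiff] at hx hy
  exact hxy ((hlast hq₁ x (hsub₁ x hx.1 hx.2) hx.1).trans
    (hlast hq₁ y (hsub₁ y hy.1 hy.2) hy.1).symm)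

theorem normalPair_image (S T₁ T₂ : Finset ℕ) (hS : 3 ≤ S.card)
    (hT₁ : 3 ≤ T₁.card) (hT₂ : 3 ≤ T₂.card) (hne : T₁ ≠ T₂)
    (hnorm : NormalPair T₁ T₂)
    (h₁ : T₁ ∩ S = ∅ ∨ IsEssentialMIComplement T₁ S)
    (h₂ : T₂ ∩ S = ∅ ∨ IsEssentialMIComplement T₂ S)
    (m : ℕ) (hm : m ∈ S) (hmin : ∀ x ∈ S, m ≤ x) :
    3 ≤ (T₁ \ (S.erase m)).card ∧ 3 ≤ (T₂ \ (S.erase m)).card ∧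
      T₁ \ (S.erase m) ≠ T₂ \ (S.erase m) ∧
      NormalPair (T₁ \ (S.erase m)) (T₂ \ (S.erase m)) := by
  obtain ⟨-, -, hmax_ne, hcases⟩ := hnorm
  obtain ⟨p, hTp⟩ := Finset.max_of_nonempty (Finset.card_pos.1 (by omega : 0 < T₁.card))
  obtain ⟨q, hTq⟩ := Finset.max_of_nonempty (Finset.card_pos.1 (by omega : 0 < T₂.card))
  obtain ⟨hp, hpmax⟩ := Finset.max_eq_coe_iff.1 hTp
  obtain ⟨hq, hqmax⟩ := Finset.max_eq_coe_iff.1 hTq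
  obtain ⟨hpf, hcard₁⟩ := mem_and_card_sdiff_erase hT₁ h₁ hm hmin hp hpmax
  obtain ⟨hqf, hcard₂⟩ := mem_and_card_sdiff_erase hT₂ h₂ hm hmin hq hqmax
  have hne' : (T₁ \ S.erase m).max ≠ (T₂ \ S.erase m).max := by
    rw [(Finset.max_eq_coe_iff.2 ⟨hpf, fun x hx => hpmax x (Finset.mem_sdiff.1 hx).1⟩).trans
      hTp.symm, (Finset.max_eq_coe_iff.2 ⟨hqf, fun x hx => hqmax x (Finset.mem_sdiff.1 hx).1⟩).trans
      hTq.symm]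
    exact hmax_ne
  refine ⟨hcard₁, hcard₂, fun h => hne' (congrArg _ h), hcard₁, hcard₂, hne', ?_⟩
  rcases hcases with h | h | h | h | h
  · left
    rw [← Finset.disjoint_iff_inter_eq_empty] at h ⊢
    exact h.mono Finset.sdiff_subset Finset.sdiff_subset
  · exact Or.inr (Or.inl (Finset.sdiff_subset_sdiff h subset_rfl))
  · exact Or.inr (Or.inr (Or.inl (Finset.sdiff_subset_sdiff h subset_rfl)))
  · have := h.sdiff_erase hmax_ne h₁ h₂ hm hmin
    tauto
  · have := h.sdiff_erase hmax_ne.symm h₂ h₁ hm hmin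
    rw [Finset.inter_comm] at this
    tauto
end

section
/- Let n ≥ 4. For every monomial order ≼ on Q′_n, there is no subset G of J_n^{DCP} such that every element of G is a nonzero polynomial of total degree at most 2 and G is a Gröbner basis of J_n^{DCP} with respect to ≼. (The De Concini–Procesi presentation of H^{•}(M̄_{0,n+1}; ℚ) admits no linear-and-quadratic commutative Gröbner basis for any admissible ordering.) -/
/-!
STATEMENT 11: the De Concini–Procesi presentation of `H^{2•}(M̄_{0,n+1}; ℚ)`.  For
`n ≥ 4`, let `L n = {S ⊆ {1,…,n} : |S| ≥ 2}`, `Q′_n = ℚ[Y_S : S ∈ L n]`, and let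
`J_n^{DCP}` be the ideal generated by: the linear elements `Σ_{S : i,j ∈ S} Y_S` for each
pair `i ≠ j` in `{1,…,n}`; and `Y_S·Y_T` for `S ∩ T ≠ ∅`, `S ⊄ T`, `T ⊄ S`.  For every
monomial order `≼` on `Q′_n`, there is no subset `G` of `J_n^{DCP}` consisting of nonzero
polynomials of total degree at most `2` that is a Gröbner basis of `J_n^{DCP}` with
respect to `≼`.
-/

open MvPolynomial

/-- Subsets of `{1,…,n}` with `|S| ≥ 2`, as a `Finset`. -/
def LFin (n : ℕ) : Finset (Finset ℕ) :=
  (Finset.Icc 1 n).powerset.filter fun S => 2 ≤ S.card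

/-- The index type of the De Concini–Procesi generators `Y_S`. -/
abbrev L (n : ℕ) := {S : Finset ℕ // S ∈ LFin n}

/-- The generators of the De Concini–Procesi ideal `J_n^{DCP}`. -/
def dcpGens (n : ℕ) : Set (MvPolynomial (L n) ℚ) :=
  -- linear relations
  {f | ∃ i j : ℕ, i ∈ Finset.Icc 1 n ∧ j ∈ Finset.Icc 1 n ∧ i ≠ j ∧
        f = ∑ S ∈ Finset.univ.filter (fun S : L n => i ∈ S.1 ∧ j ∈ S.1), X S} ∪
  -- quadratic monomial relations
  {f | ∃ S T : L n, (S.1 ∩ T.1).Nonempty ∧ ¬ S.1 ⊆ T.1 ∧ ¬ T.1 ⊆ S.1 ∧ f = X S * X T}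

/-- The De Concini–Procesi ideal. -/
noncomputable def dcpIdeal (n : ℕ) : Ideal (MvPolynomial (L n) ℚ) := Ideal.span (dcpGens n)

/-- `m` is the `≼`-leading monomial of `f`. -/
def IsLeadingMonomial {σ : Type*} (mo : MonomialOrder σ)
    (f : MvPolynomial σ ℚ) (m : σ →₀ ℕ) : Prop :=
  m ∈ f.support ∧ ∀ m' ∈ f.support, mo.toSyn m' ≤ mo.toSyn m

/-- A splitting of `V` into two parts with at least two elements each. -/
structure IsSplit (V A B : Finset ℕ) : Prop where
  union_eq : A ∪ B = V
  disj : Disjoint A B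
  left : 1 < A.card
  right : 1 < B.card

/-- `T` consists of one element of `A` and one element of `B`. -/
def IsMixed (A B T : Finset ℕ) : Prop := ∃ a ∈ A, ∃ b ∈ B, T = {a, b}

open Classical in
/-- The coefficient of the hyperplane class in the restriction of `Y_T` to the plane attached to
the splitting `A ∪ B`. -/
noncomputable def hyperplaneCoeff (A B T : Finset ℕ) : ℚ :=
  (if T = A then 1 else 0) + (if T = B then 1 else 0) + (if IsMixed A B T then 1 else 0)
    - (if T = A ∪ B then 1 else 0)

/-- The part of the splitting that does not contain `x`. -/
def otherSide (A B : Finset ℕ) (x : ℕ) : Finset ℕ := if x ∈ A then B else A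

open Classical in
/-- Minus the coefficient of the `x`-th exceptional class in the restriction of `Y_T`. -/
noncomputable def exceptionalCoeff (A B : Finset ℕ) (x : ℕ) (T : Finset ℕ) : ℚ :=
  (if T = otherSide A B x then 1 else 0) + (if IsMixed A B T ∧ x ∈ T then 1 else 0)
    - (if T = insert x (otherSide A B x) then 1 else 0)

/-- The intersection number of `Y_S` and `Y_T` on the blown-up plane. -/
noncomputable def pairing (A B S T : Finset ℕ) : ℚ :=
  hyperplaneCoeff A B S * hyperplaneCoeff A B T
    - ∑ x ∈ A ∪ B, exceptionalCoeff A B x S * exceptionalCoeff A B x T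

namespace IsSplit

variable {V A B : Finset ℕ}

theorem swap (h : IsSplit V A B) : IsSplit V B A :=
  ⟨by rw [Finset.union_comm, h.union_eq], h.disj.symm, h.right, h.left⟩

theorem isMixed_swap (A B : Finset ℕ) : IsMixed B A = IsMixed A B := by
  funext T
  apply propext
  constructor <;> rintro ⟨a, ha, b, hb, rfl⟩ <;> exact ⟨b, hb, a, ha, Finset.pair_comm _ _⟩

theorem hyperplaneCoeff_swap (A B T : Finset ℕ) :
    hyperplaneCoeff B A T = hyperplaneCoeff A B T := by
  rw [hyperplaneCoeff, hyperplaneCoeff, isMixed_swap A B, Finset.union_comm B A]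
  ring

theorem exceptionalCoeff_swap (h : IsSplit V A B) {x : ℕ} (hx : x ∈ V) (T : Finset ℕ) :
    exceptionalCoeff B A x T = exceptionalCoeff A B x T := by
  have : otherSide B A x = otherSide A B x := by
    have h1 := h.union_eq
    have h2 := Finset.disjoint_left.1 h.disj
    unfold otherSide
    grind
  rw [exceptionalCoeff, exceptionalCoeff, isMixed_swap A B, this]

theorem not_isMixed (h : IsSplit V A B) {T : Finset ℕ} {a a' : ℕ} (hne : a ≠ a') (ha : a ∈ T)
    (ha' : a' ∈ T) (h' : a ∈ A ∧ a' ∈ A ∨ a ∈ B ∧ a' ∈ B) : ¬ IsMixed A B T := by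
  rintro ⟨c, hc, d, hd, rfl⟩
  have h2 := Finset.disjoint_left.1 h.disj
  grind

theorem hyperplaneCoeff_left (h : IsSplit V A B) : hyperplaneCoeff A B A = 1 := by
  obtain ⟨a, ha, a', ha', haa⟩ := Finset.one_lt_card.1 h.left
  obtain ⟨b, hb, b', hb', hbb⟩ := Finset.one_lt_card.1 h.right
  have h2 := Finset.disjoint_left.1 h.disj
  have e1 : A ≠ B := by grind
  have e2 : ¬ IsMixed A B A := h.not_isMixed haa (by simp [ha]) (by simp [ha']) (.inl ⟨ha, ha'⟩)
  have e3 : A ≠ A ∪ B := by grind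
  simp [hyperplaneCoeff, e1, e2, e3]

theorem exceptionalCoeff_left (h : IsSplit V A B) {x : ℕ} (hx : x ∈ V) :
    exceptionalCoeff A B x A = if x ∈ B then 1 else 0 := by
  obtain ⟨a, ha, a', ha', haa⟩ := Finset.one_lt_card.1 h.left
  obtain ⟨b, hb, b', hb', hbb⟩ := Finset.one_lt_card.1 h.right
  have h2 := Finset.disjoint_left.1 h.disj
  have h1 := h.union_eq
  have e2 : ¬ IsMixed A B A := h.not_isMixed haa (by simp [ha]) (by simp [ha']) (.inl ⟨ha, ha'⟩)
  have e3 : A ≠ insert x (otherSide A B x) := by unfold otherSide; grind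
  have e1 : A = otherSide A B x ↔ x ∈ B := by unfold otherSide; grind
  simp [exceptionalCoeff, e2, e3, ← e1]

theorem hyperplaneCoeff_mixed (h : IsSplit V A B) {T : Finset ℕ} (hT : IsMixed A B T) :
    hyperplaneCoeff A B T = 1 := by
  obtain ⟨a, ha, a', ha', haa⟩ := Finset.one_lt_card.1 h.left
  obtain ⟨b, hb, b', hb', hbb⟩ := Finset.one_lt_card.1 h.right
  have h2 := Finset.disjoint_left.1 h.disj
  have e : T ≠ A ∧ T ≠ B ∧ T ≠ A ∪ B := by
    refine ⟨?_, ?_, ?_⟩ <;> rintro rfl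
    · exact h.not_isMixed haa ha ha' (.inl ⟨ha, ha'⟩) hT
    · exact h.not_isMixed hbb hb hb' (.inr ⟨hb, hb'⟩) hT
    · exact h.not_isMixed haa (by simp [ha]) (by simp [ha']) (.inl ⟨ha, ha'⟩) hT
  simp [hyperplaneCoeff, hT, e]

theorem exceptionalCoeff_mixed (h : IsSplit V A B) {T : Finset ℕ} (hT : IsMixed A B T) (x : ℕ) :
    exceptionalCoeff A B x T = if x ∈ T then 1 else 0 := by
  obtain ⟨a, ha, a', ha', haa⟩ := Finset.one_lt_card.1 h.left
  obtain ⟨b, hb, b', hb', hbb⟩ := Finset.one_lt_card.1 h.right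
  have h2 := Finset.disjoint_left.1 h.disj
  have e : T ≠ otherSide A B x ∧ T ≠ insert x (otherSide A B x) := by
    have hx : otherSide A B x = A ∨ otherSide A B x = B := by unfold otherSide; grind
    rcases hx with hx | hx <;> rw [hx] <;> refine ⟨?_, ?_⟩ <;> rintro rfl
    · exact h.not_isMixed haa ha ha' (.inl ⟨ha, ha'⟩) hT
    · exact h.not_isMixed haa (by simp [ha]) (by simp [ha']) (.inl ⟨ha, ha'⟩) hT
    · exact h.not_isMixed hbb hb hb' (.inr ⟨hb, hb'⟩) hT
    · exact h.not_isMixed hbb (by simp [hb]) (by simp [hb']) (.inr ⟨hb, hb'⟩) hT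
  simp [exceptionalCoeff, hT, e]

theorem hyperplaneCoeff_insert (h : IsSplit V A B) {b : ℕ} (hb : b ∈ B) :
    hyperplaneCoeff A B (insert b A) = 0 := by
  obtain ⟨a, ha, a', ha', haa⟩ := Finset.one_lt_card.1 h.left
  obtain ⟨c, hc, c', hc', hcc⟩ := Finset.one_lt_card.1 h.right
  have h2 := Finset.disjoint_left.1 h.disj
  have e1 : insert b A ≠ A := by grind
  have e2 : insert b A ≠ B := by grind
  have e3 : ¬ IsMixed A B (insert b A) :=
    h.not_isMixed haa (by simp [ha]) (by simp [ha']) (.inl ⟨ha, ha'⟩)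
  have e4 : insert b A ≠ A ∪ B := fun e => by
    have q : ∀ z ∈ B, z = b := fun z hz => by
      have : z ∈ insert b A := e ▸ Finset.mem_union_right A hz
      grind
    exact hcc ((q c hc).trans (q c' hc').symm)
  simp [hyperplaneCoeff, e1, e2, e3, e4, -Finset.insert_eq_self]

theorem exceptionalCoeff_insert (h : IsSplit V A B) {b : ℕ} (hb : b ∈ B) (x : ℕ) :
    exceptionalCoeff A B x (insert b A) = if x = b then -1 else 0 := by
  obtain ⟨a, ha, a', ha', haa⟩ := Finset.one_lt_card.1 h.left
  obtain ⟨c, hc, c', hc', hcc⟩ := Finset.one_lt_card.1 h.right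
  have h2 := Finset.disjoint_left.1 h.disj
  have e1 : insert b A ≠ otherSide A B x := by unfold otherSide; grind
  have e3 : ¬ IsMixed A B (insert b A) :=
    h.not_isMixed haa (by simp [ha]) (by simp [ha']) (.inl ⟨ha, ha'⟩)
  have e4 : insert b A = insert x (otherSide A B x) ↔ x = b := by
    unfold otherSide
    split_ifs with hxA
    · refine ⟨fun e => absurd haa ?_, fun e => absurd hb (h2 (e ▸ hxA))⟩
      have q : ∀ z ∈ A, z = x := fun z hz => by
        have : z ∈ insert x B := e ▸ Finset.mem_insert_of_mem hz
        grind
      rw [q a ha, q a' ha']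
      simp
    · refine ⟨fun e => ?_, fun e => by rw [e]⟩
      have : b ∈ insert x A := e ▸ Finset.mem_insert_self b A
      grind
  simp only [exceptionalCoeff, e1, e3, e4]
  split_ifs <;> simp_all

theorem hyperplaneCoeff_union (h : IsSplit V A B) : hyperplaneCoeff A B (A ∪ B) = -1 := by
  obtain ⟨a, ha, a', ha', haa⟩ := Finset.one_lt_card.1 h.left
  obtain ⟨b, hb, b', hb', hbb⟩ := Finset.one_lt_card.1 h.right
  have h2 := Finset.disjoint_left.1 h.disj
  have e1 : A ∪ B ≠ A := by grind
  have e2 : A ∪ B ≠ B := by grind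
  have e3 : ¬ IsMixed A B (A ∪ B) :=
    h.not_isMixed haa (by simp [ha]) (by simp [ha']) (.inl ⟨ha, ha'⟩)
  simp only [hyperplaneCoeff, e1, e2, e3]
  simp

theorem exceptionalCoeff_union (h : IsSplit V A B) (x : ℕ) :
    exceptionalCoeff A B x (A ∪ B) = 0 := by
  obtain ⟨a, ha, a', ha', haa⟩ := Finset.one_lt_card.1 h.left
  obtain ⟨b, hb, b', hb', hbb⟩ := Finset.one_lt_card.1 h.right
  have h2 := Finset.disjoint_left.1 h.disj
  have e1 : A ∪ B ≠ otherSide A B x := by unfold otherSide; grind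
  have e2 : A ∪ B ≠ insert x (otherSide A B x) := fun e => by
    have q : ∀ z ∈ A ∪ B, z ∈ insert x (otherSide A B x) := fun z hz => e ▸ hz
    have := q a (by simp [ha])
    have := q a' (by simp [ha'])
    have := q b (by simp [hb])
    have := q b' (by simp [hb'])
    unfold otherSide at *
    grind
  have e3 : ¬ IsMixed A B (A ∪ B) :=
    h.not_isMixed haa (by simp [ha]) (by simp [ha']) (.inl ⟨ha, ha'⟩)
  simp [exceptionalCoeff, e1, e2, e3]

theorem eq_zero_or_isFlat (h : IsSplit V A B) (T : Finset ℕ) :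
    (hyperplaneCoeff A B T = 0 ∧ ∀ x ∈ A ∪ B, exceptionalCoeff A B x T = 0) ∨
      T = A ∨ T = B ∨ IsMixed A B T ∨ (∃ b ∈ B, T = insert b A) ∨
      (∃ a ∈ A, T = insert a B) ∨ T = A ∪ B := by
  by_contra! hc
  obtain ⟨h0, h1, h2, h3, h4, h5, h6⟩ := hc
  obtain ⟨x, hx, hx0⟩ := h0 (by simp [hyperplaneCoeff, h1, h2, h3, h6])
  have hd := Finset.disjoint_left.1 h.disj
  have e1 : T ≠ otherSide A B x := by unfold otherSide; grind
  have e2 : T ≠ insert x (otherSide A B x) := by unfold otherSide; grind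
  simp [exceptionalCoeff, h3, e1, e2] at hx0

theorem pairing_comm (A B S T : Finset ℕ) : pairing A B S T = pairing A B T S := by
  simp only [pairing, mul_comm]

theorem pairing_eq_zero_of_coeff (S : Finset ℕ) {T : Finset ℕ}
    (hT : hyperplaneCoeff A B T = 0 ∧ ∀ x ∈ A ∪ B, exceptionalCoeff A B x T = 0) :
    pairing A B S T = 0 := by
  rw [pairing, hT.1, Finset.sum_eq_zero fun x hx => by rw [hT.2 x hx, mul_zero]]
  simp

theorem pairing_swap (h : IsSplit V A B) (S T : Finset ℕ) :
    pairing B A S T = pairing A B S T := by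
  have hV := h.union_eq
  simp only [pairing, hyperplaneCoeff_swap A B, Finset.union_comm B A]
  congr 1
  refine Finset.sum_congr rfl fun x hx => ?_
  rw [h.exceptionalCoeff_swap (hV ▸ hx), h.exceptionalCoeff_swap (hV ▸ hx)]

theorem pairing_left_mixed (h : IsSplit V A B) {T : Finset ℕ} (hT : IsMixed A B T) :
    pairing A B A T = 0 := by
  have hV := h.union_eq
  have hd := Finset.disjoint_left.1 h.disj
  rw [pairing, h.hyperplaneCoeff_left, h.hyperplaneCoeff_mixed hT, Finset.sum_congr rfl fun x hx =>
    show _ = if x ∈ B ∩ T then (1 : ℚ) else 0 by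
      rw [h.exceptionalCoeff_left (hV ▸ hx), h.exceptionalCoeff_mixed hT]
      split_ifs <;> simp_all]
  obtain ⟨a, ha, b, hb, rfl⟩ := hT
  rw [show B ∩ {a, b} = {b} by grind]
  simp [hb]

theorem pairing_mixed_mixed (h : IsSplit V A B) {S T : Finset ℕ} (hS : IsMixed A B S)
    (hT : IsMixed A B T) (hST : (S ∩ T).Nonempty) (hne : S ≠ T) : pairing A B S T = 0 := by
  have hV := h.union_eq
  have hd := Finset.disjoint_left.1 h.disj
  rw [pairing, h.hyperplaneCoeff_mixed hS, h.hyperplaneCoeff_mixed hT, Finset.sum_congr rfl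
    fun x hx => show _ = if x ∈ S ∩ T then (1 : ℚ) else 0 by
      rw [h.exceptionalCoeff_mixed hS, h.exceptionalCoeff_mixed hT]
      split_ifs <;> simp_all]
  obtain ⟨c, hc⟩ := hST
  obtain ⟨a, ha, b, hb, rfl⟩ := hS
  obtain ⟨a', ha', b', hb', rfl⟩ := hT
  rw [show ({a, b} ∩ {a', b'} : Finset ℕ) = {c} by grind]
  have : c ∈ A ∪ B := by grind
  simp only [Finset.mem_singleton, Finset.sum_ite_eq', this]
  simp

theorem pairing_insert (h : IsSplit V A B) {b : ℕ} (hb : b ∈ B) {T : Finset ℕ} :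
    pairing A B (insert b A) T = exceptionalCoeff A B b T := by
  have hV := h.union_eq
  rw [pairing, h.hyperplaneCoeff_insert hb, Finset.sum_congr rfl fun x hx =>
    show _ = if x = b then -exceptionalCoeff A B x T else (0 : ℚ) by
      rw [h.exceptionalCoeff_insert hb]
      split_ifs <;> simp]
  simp [hb]

theorem pairing_insert_eq_zero (h : IsSplit V A B) {b : ℕ} (hb : b ∈ B) {T : Finset ℕ}
    (h1 : ¬ T ⊆ insert b A) (h3 : (insert b A ∩ T).Nonempty) :
    pairing A B (insert b A) T = 0 := by
  rw [h.pairing_insert hb]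
  have hV := h.union_eq
  have hbV : b ∈ V := by grind
  have hd := Finset.disjoint_left.1 h.disj
  have hbA : b ∉ A := fun hh => hd hh hb
  rcases h.eq_zero_or_isFlat T with h0 | rfl | rfl | hT | ⟨c, hc, rfl⟩ | ⟨c, hc, rfl⟩ | rfl
  · exact h0.2 b (hV ▸ hbV)
  · exact absurd (Finset.subset_insert _ _) h1
  · rw [← h.exceptionalCoeff_swap hbV, h.swap.exceptionalCoeff_left hbV, if_neg hbA]
  · rw [h.exceptionalCoeff_mixed hT, if_neg]
    obtain ⟨a', ha', b', hb', rfl⟩ := hT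
    grind
  · rw [h.exceptionalCoeff_insert hc, if_neg]
    rintro rfl
    exact h1 subset_rfl
  · rw [← h.exceptionalCoeff_swap hbV, h.swap.exceptionalCoeff_insert hc, if_neg]
    grind
  · exact h.exceptionalCoeff_union b

theorem pairing_left_eq_zero (h : IsSplit V A B) {T : Finset ℕ} (h0 : (A ∩ T).Nonempty)
    (h1 : ¬ A ⊆ T) (h2 : ¬ T ⊆ A) : pairing A B A T = 0 := by
  rcases h.eq_zero_or_isFlat T with hT | rfl | rfl | hT | ⟨b, hb, rfl⟩ | ⟨a, ha, rfl⟩ | rfl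
  · exact pairing_eq_zero_of_coeff _ hT
  · exact absurd subset_rfl h1
  · rw [Finset.disjoint_iff_inter_eq_empty.1 h.disj] at h0
    exact absurd rfl h0.ne_empty
  · exact h.pairing_left_mixed hT
  · exact absurd (Finset.subset_insert _ _) h1
  · rw [← h.pairing_swap, pairing_comm]
    exact h.swap.pairing_insert_eq_zero ha h1 (by rwa [Finset.inter_comm])
  · exact absurd Finset.subset_union_left h1

theorem pairing_eq_zero (h : IsSplit V A B) {S T : Finset ℕ} (hS : S ⊆ V) (hT : T ⊆ V)
    (h0 : (S ∩ T).Nonempty) (h1 : ¬ S ⊆ T) (h2 : ¬ T ⊆ S) : pairing A B S T = 0 := by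
  have hV := h.union_eq
  have h0' : (T ∩ S).Nonempty := by rwa [Finset.inter_comm]
  rcases h.eq_zero_or_isFlat S with hS' | rfl | rfl | hS' | ⟨b, hb, rfl⟩ | ⟨a, ha, rfl⟩ | rfl
  · rw [pairing_comm]
    exact pairing_eq_zero_of_coeff _ hS'
  · exact h.pairing_left_eq_zero h0 h1 h2
  · rw [← h.pairing_swap]
    exact h.swap.pairing_left_eq_zero h0 h1 h2
  · rcases h.eq_zero_or_isFlat T with hT' | rfl | rfl | hT' | ⟨b, hb, rfl⟩ | ⟨a, ha, rfl⟩ | rfl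
    · exact pairing_eq_zero_of_coeff _ hT'
    · rw [pairing_comm]
      exact h.pairing_left_mixed hS'
    · rw [← h.pairing_swap, pairing_comm]
      exact h.swap.pairing_left_mixed (isMixed_swap A T ▸ hS')
    · exact h.pairing_mixed_mixed hS' hT' h0 fun e => h1 e.subset
    · rw [pairing_comm]
      exact h.pairing_insert_eq_zero hb h1 h0'
    · rw [← h.pairing_swap, pairing_comm]
      exact h.swap.pairing_insert_eq_zero ha h1 h0'
    · exact absurd (hS.trans hV.superset) h1
  · exact h.pairing_insert_eq_zero hb h2 h0
  · rw [← h.pairing_swap]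
    exact h.swap.pairing_insert_eq_zero ha h2 h0
  · exact absurd (hT.trans hV.superset) h2

theorem pairing_left_self (h : IsSplit V A B) : pairing A B A A = 1 - B.card := by
  have hV := h.union_eq
  rw [pairing, h.hyperplaneCoeff_left, Finset.sum_congr rfl fun x hx =>
    show _ = if x ∈ B then (1 : ℚ) else 0 by
      rw [h.exceptionalCoeff_left (hV ▸ hx)]
      split_ifs <;> simp]
  rw [← Finset.sum_filter, Finset.filter_mem_eq_inter,
    Finset.inter_eq_right.2 Finset.subset_union_right]
  simp

theorem pairing_insert_self (h : IsSplit V A B) {b : ℕ} (hb : b ∈ B) :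
    pairing A B (insert b A) (insert b A) = -1 := by
  have hV := h.union_eq
  rw [h.pairing_insert hb, h.exceptionalCoeff_insert hb]
  simp

theorem pairing_union_self (h : IsSplit V A B) : pairing A B (A ∪ B) (A ∪ B) = 1 := by
  simp [pairing, h.hyperplaneCoeff_union, h.exceptionalCoeff_union]

end IsSplit

theorem exists_isSplit_pairing_self_ne_zero {V S : Finset ℕ} (hV : 4 ≤ V.card) (hS : S ⊆ V)
    (hS2 : 2 ≤ S.card) : ∃ A B, IsSplit V A B ∧ pairing A B S S ≠ 0 := by
  have hc := Finset.card_sdiff_add_card_eq_card hS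
  rcases Nat.lt_or_ge 1 (V \ S).card with h | h
  · have hs : IsSplit V S (V \ S) := ⟨by simp [hS], Finset.disjoint_sdiff, hS2, h⟩
    refine ⟨S, V \ S, hs, ?_⟩
    rw [hs.pairing_left_self, sub_ne_zero]
    exact_mod_cast h.ne
  · obtain ⟨a, ha⟩ : S.Nonempty := Finset.card_pos.1 (by omega)
    by_cases hSV : S = V
    · subst hSV
      obtain ⟨A, hA, hAc⟩ := Finset.exists_subset_card_eq hS2
      have := Finset.card_sdiff_add_card_eq_card hA
      have hs : IsSplit S A (S \ A) := ⟨by simp [hA], Finset.disjoint_sdiff, by omega, by omega⟩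
      refine ⟨A, S \ A, hs, ?_⟩
      have := hs.pairing_union_self
      rw [hs.union_eq] at this
      simp [this]
    · have hne : (V \ S).Nonempty := by
        rw [Finset.sdiff_nonempty]
        exact fun hh => hSV (hS.antisymm hh)
      obtain ⟨m, hm⟩ := hne
      have hu : V \ S = {m} := by
        obtain ⟨c, hc⟩ := Finset.card_eq_one.1 (le_antisymm h (Finset.card_pos.2 ⟨m, hm⟩))
        grind
      have hmem : ∀ x, x ∈ V ↔ x ∈ S ∨ x = m := fun x => by
        have : x ∈ V \ S ↔ x = m := by simp [hu]
        grind
      have hmS : m ∉ S := by grind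
      have hs : IsSplit V (S.erase a) {a, m} := by
        refine ⟨?_, ?_, ?_, ?_⟩
        · ext x; grind
        · rw [Finset.disjoint_left]; grind
        · rw [Finset.card_erase_of_mem ha]
          rw [hu, Finset.card_singleton] at hc
          omega
        · rw [Finset.card_pair (by grind)]; simp
      refine ⟨_, _, hs, ?_⟩
      have := hs.pairing_insert_self (b := a) (by simp)
      rw [Finset.insert_erase ha] at this
      simp [this]

section LinearRelations

variable {n : ℕ} {A B : Finset ℕ} {i j : ℕ}

theorem sum_ite_eq_of_subset {U : Finset ℕ} (hU : U ⊆ Finset.Icc 1 n) (hij : i ≠ j) :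
    ∑ S ∈ Finset.univ.filter (fun S : L n => i ∈ S.1 ∧ j ∈ S.1),
      (if S.1 = U then (1 : ℚ) else 0) = if i ∈ U ∧ j ∈ U then 1 else 0 := by
  split_ifs with h
  · have hL : U ∈ LFin n := by
      rw [LFin, Finset.mem_filter, Finset.mem_powerset]
      exact ⟨hU, Finset.one_lt_card.2 ⟨i, h.1, j, h.2, hij⟩⟩
    rw [Finset.sum_eq_single_of_mem (⟨U, hL⟩ : L n) (by simp [h])]
    · simp
    · intro S _ hS
      exact if_neg fun e => hS (Subtype.ext e)
  · refine Finset.sum_eq_zero fun S hS => if_neg ?_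
    rintro rfl
    exact h (Finset.mem_filter.1 hS).2

theorem isMixed_iff (h : IsSplit (Finset.Icc 1 n) A B) (hi : i ∈ Finset.Icc 1 n)
    (hj : j ∈ Finset.Icc 1 n) (hij : i ≠ j) {T : Finset ℕ} (hiT : i ∈ T) (hjT : j ∈ T) :
    IsMixed A B T ↔ T = {i, j} ∧ (i ∈ A ↔ j ∉ A) := by
  have h1 := h.union_eq
  have h2 := Finset.disjoint_left.1 h.disj
  constructor
  · rintro ⟨a, ha, b, hb, rfl⟩
    grind
  · rintro ⟨rfl, hA⟩
    by_cases hiA : i ∈ A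
    · exact ⟨i, hiA, j, by grind, rfl⟩
    · exact ⟨j, by grind, i, by grind, Finset.pair_comm _ _⟩

theorem sum_ite_of_isMixed (h : IsSplit (Finset.Icc 1 n) A B) (hi : i ∈ Finset.Icc 1 n)
    (hj : j ∈ Finset.Icc 1 n) (hij : i ≠ j) {P : Finset ℕ → Prop} [DecidablePred P]
    (hP : ∀ S, P S → IsMixed A B S) :
    ∑ S ∈ Finset.univ.filter (fun S : L n => i ∈ S.1 ∧ j ∈ S.1),
      (if P S.1 then (1 : ℚ) else 0) = if P {i, j} then 1 else 0 := by
  have hsub : ({i, j} : Finset ℕ) ⊆ Finset.Icc 1 n := by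
    rw [Finset.insert_subset_iff, Finset.singleton_subset_iff]
    exact ⟨hi, hj⟩
  have key : ∀ S ∈ Finset.univ.filter (fun S : L n => i ∈ S.1 ∧ j ∈ S.1), P S.1 → S.1 = {i, j} := by
    intro S hS hPS
    obtain ⟨-, hiS, hjS⟩ := Finset.mem_filter.1 hS
    exact ((isMixed_iff h hi hj hij hiS hjS).1 (hP _ hPS)).1
  split_ifs with hd
  · rw [Finset.sum_congr rfl fun S hS => if_congr (Q := S.1 = {i, j})
      ⟨key S hS, fun e => e ▸ hd⟩ rfl rfl, sum_ite_eq_of_subset hsub hij]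
    simp
  · exact Finset.sum_eq_zero fun S hS => if_neg fun hPS => hd (key S hS hPS ▸ hPS)

theorem sum_hyperplaneCoeff (h : IsSplit (Finset.Icc 1 n) A B) (hi : i ∈ Finset.Icc 1 n)
    (hj : j ∈ Finset.Icc 1 n) (hij : i ≠ j) :
    ∑ S ∈ Finset.univ.filter (fun S : L n => i ∈ S.1 ∧ j ∈ S.1), hyperplaneCoeff A B S.1 = 0 := by
  classical
  have h1 := h.union_eq
  have h2 := Finset.disjoint_left.1 h.disj
  have hm := isMixed_iff h hi hj hij (T := {i, j}) (by simp) (by simp)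
  simp only [hyperplaneCoeff, Finset.sum_sub_distrib, Finset.sum_add_distrib]
  rw [sum_ite_of_isMixed (P := IsMixed A B) h hi hj hij fun S => id,
    sum_ite_eq_of_subset (h1 ▸ Finset.subset_union_left) hij,
    sum_ite_eq_of_subset (h1 ▸ Finset.subset_union_right) hij, sum_ite_eq_of_subset h1.subset hij]
  rw [← h1] at hi hj
  grind

theorem sum_exceptionalCoeff (h : IsSplit (Finset.Icc 1 n) A B) (hi : i ∈ Finset.Icc 1 n)
    (hj : j ∈ Finset.Icc 1 n) (hij : i ≠ j) {x : ℕ} (hx : x ∈ Finset.Icc 1 n) :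
    ∑ S ∈ Finset.univ.filter (fun S : L n => i ∈ S.1 ∧ j ∈ S.1),
      exceptionalCoeff A B x S.1 = 0 := by
  classical
  have h1 := h.union_eq
  have h2 := Finset.disjoint_left.1 h.disj
  have hm := isMixed_iff h hi hj hij (T := {i, j}) (by simp) (by simp)
  have ho : otherSide A B x ⊆ Finset.Icc 1 n := by
    rw [otherSide, ← h1]
    split_ifs
    exacts [Finset.subset_union_right, Finset.subset_union_left]
  simp only [exceptionalCoeff, Finset.sum_sub_distrib, Finset.sum_add_distrib]
  rw [sum_ite_of_isMixed (P := fun S => IsMixed A B S ∧ x ∈ S) h hi hj hij fun S hS => hS.1,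
    sum_ite_eq_of_subset ho hij, sum_ite_eq_of_subset (Finset.insert_subset hx ho) hij]
  rw [← h1] at hi hj hx
  unfold otherSide
  grind

end LinearRelations

section Functional

variable {σ : Type*}

/-- The constant coefficient of the second derivative of `f` in the direction `v`. -/
noncomputable def secondDeriv (v : σ → ℚ) : MvPolynomial σ ℚ →ₗ[ℚ] ℚ :=
  (lcoeff ℚ 0) ∘ₗ (mkDerivation ℚ fun s => (C (v s) : MvPolynomial σ ℚ)).toLinearMap ∘ₗ
    (mkDerivation ℚ fun s => (C (v s) : MvPolynomial σ ℚ)).toLinearMap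

theorem secondDeriv_apply (v : σ → ℚ) (f : MvPolynomial σ ℚ) :
    secondDeriv v f = constantCoeff (mkDerivation ℚ (fun s => (C (v s) : MvPolynomial σ ℚ))
      (mkDerivation ℚ (fun s => (C (v s) : MvPolynomial σ ℚ)) f)) := rfl

theorem secondDeriv_mul_sum_X (v : σ → ℚ) (f : MvPolynomial σ ℚ) (s : Finset σ)
    (hs : ∑ i ∈ s, v i = 0) : secondDeriv v (f * ∑ i ∈ s, X i) = 0 := by
  have hD : mkDerivation ℚ (fun s => (C (v s) : MvPolynomial σ ℚ)) (∑ i ∈ s, X i) = 0 := by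
    simp only [map_sum, mkDerivation_X]
    rw [← map_sum, hs, map_zero]
  simp [secondDeriv_apply, Derivation.leibniz, hD]

theorem secondDeriv_mul_X_mul_X (v : σ → ℚ) (f : MvPolynomial σ ℚ) (s t : σ) :
    secondDeriv v (f * (X s * X t)) = constantCoeff f * (2 * (v s * v t)) := by
  simp [secondDeriv_apply, Derivation.leibniz, mkDerivation_X]
  exact .inl (by ring)

theorem secondDeriv_monomial_of_degree_lt (v : σ → ℚ) {d : σ →₀ ℕ} (hd : d.degree < 2) (c : ℚ) :
    secondDeriv v (monomial d c) = 0 := by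
  rcases Nat.lt_or_ge d.degree 1 with h | h
  · have : d = 0 := by rw [← Finsupp.degree_eq_zero_iff]; omega
    subst this
    simp [secondDeriv_apply]
  · obtain ⟨s, rfl⟩ : d ∈ Set.range fun a : σ => Finsupp.single a 1 := by
      rw [Finsupp.range_single_one]
      exact le_antisymm (Nat.le_of_lt_succ hd) h
    rw [show monomial (Finsupp.single s 1) c = c • (X s : MvPolynomial σ ℚ) by
      simp [X, smul_monomial]]
    simp [secondDeriv_apply, mkDerivation_X]

/-- The degree-two functional attached to the intersection pairing of a splitting. -/
noncomputable def degreeTwoFunctional {n : ℕ} (A B : Finset ℕ) :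
    MvPolynomial (L n) ℚ →ₗ[ℚ] ℚ :=
  secondDeriv (fun S => hyperplaneCoeff A B S.1) -
    ∑ x ∈ A ∪ B, secondDeriv (fun S => exceptionalCoeff A B x S.1)

variable {n : ℕ} {A B : Finset ℕ}

theorem degreeTwoFunctional_mul_X_mul_X (f : MvPolynomial (L n) ℚ) (S T : L n) :
    degreeTwoFunctional A B (f * (X S * X T)) =
      constantCoeff f * (2 * pairing A B S.1 T.1) := by
  simp only [degreeTwoFunctional, LinearMap.sub_apply, LinearMap.sum_apply,
    secondDeriv_mul_X_mul_X, pairing, mul_sub, Finset.mul_sum]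

theorem degreeTwoFunctional_monomial_of_degree_lt {d : L n →₀ ℕ} (hd : d.degree < 2) (c : ℚ) :
    degreeTwoFunctional A B (monomial d c) = 0 := by
  simp [degreeTwoFunctional, secondDeriv_monomial_of_degree_lt _ hd]

theorem degreeTwoFunctional_eq_zero (h : IsSplit (Finset.Icc 1 n) A B)
    {f : MvPolynomial (L n) ℚ} (hf : f ∈ dcpIdeal n) : degreeTwoFunctional A B f = 0 := by
  have hV := h.union_eq
  refine Submodule.closure_induction (p := fun f _ => degreeTwoFunctional A B f = 0)
    (map_zero _) (fun f g _ _ hf hg => by rw [map_add, hf, hg, add_zero]) ?_ hf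
  rintro f _ (⟨i, j, hi, hj, hij, rfl⟩ | ⟨S, T, h0, h1, h2, rfl⟩)
  · rw [smul_eq_mul, degreeTwoFunctional, LinearMap.sub_apply, LinearMap.sum_apply,
      secondDeriv_mul_sum_X _ _ _ (sum_hyperplaneCoeff h hi hj hij), Finset.sum_eq_zero, sub_zero]
    intro x hx
    exact secondDeriv_mul_sum_X _ _ _ (sum_exceptionalCoeff h hi hj hij (hV ▸ hx))
  · have hsub : ∀ S : L n, S.1 ⊆ Finset.Icc 1 n := fun S =>
      Finset.mem_powerset.1 (Finset.mem_filter.1 S.2).1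
    rw [smul_eq_mul, degreeTwoFunctional_mul_X_mul_X,
      h.pairing_eq_zero (hsub S) (hsub T) h0 h1 h2]
    simp

end Functional

theorem X_mem_of_isPrime {n : ℕ} {P : Ideal (MvPolynomial (L n) ℚ)} (hP : P.IsPrime)
    (hJ : dcpIdeal n ≤ P) (S : L n) : X S ∈ P := by
  classical
  by_contra hS
  obtain ⟨M, hM, hmax⟩ := Finset.exists_max_image
    (Finset.univ.filter fun S : L n => (X S : MvPolynomial (L n) ℚ) ∉ P)
    (fun S => S.1.card) ⟨S, by simpa using hS⟩
  replace hM : X M ∉ P := by simpa using hM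
  replace hmax : ∀ T : L n, X T ∉ P → T.1.card ≤ M.1.card := fun T hT => hmax T (by simpa using hT)
  have nested : ∀ T U : L n, X T ∉ P → X U ∉ P → (T.1 ∩ U.1).Nonempty →
      T.1 ⊆ U.1 ∨ U.1 ⊆ T.1 := by
    intro T U hT hU hne
    by_contra! hc
    have : X T * X U ∈ P := hJ (Ideal.subset_span (.inr ⟨T, U, hne, hc.1, hc.2, rfl⟩))
    exact (hP.mem_or_mem this).elim hT hU
  obtain ⟨hMV, hM2⟩ := Finset.mem_filter.1 M.2
  obtain ⟨i, hi, k, hk, hik⟩ := Finset.one_lt_card.1 hM2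
  obtain ⟨N, hN, hNmax⟩ := Finset.exists_max_image
    (M.1.ssubsets.filter fun U => U = {i} ∨ ∃ T : L n, T.1 = U ∧ i ∈ U ∧ X T ∉ P)
    Finset.card ⟨{i}, by
      simp only [Finset.mem_filter, Finset.mem_ssubsets, true_or, and_true]
      refine Finset.ssubset_iff_subset_ne.2 ⟨by simpa using hi, fun e => hik ?_⟩
      rw [← e] at hk
      exact (Finset.mem_singleton.1 hk).symm⟩
  rw [Finset.mem_filter, Finset.mem_ssubsets] at hN
  obtain ⟨hNM, hN⟩ := hN
  obtain ⟨j, hj, hjN⟩ := Finset.exists_of_ssubset hNM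
  have hiN : i ∈ N := by
    rcases hN with rfl | ⟨T, rfl, hiT, -⟩
    exacts [Finset.mem_singleton_self i, hiT]
  have hij : i ≠ j := fun e => hjN (e ▸ hiN)
  rw [Finset.mem_powerset] at hMV
  have hsum : ∑ S ∈ Finset.univ.filter (fun S : L n => i ∈ S.1 ∧ j ∈ S.1), X S ∈ P :=
    hJ (Ideal.subset_span (.inl ⟨i, j, hMV hi, hMV hj, hij, rfl⟩))
  rw [← Finset.add_sum_erase _ _ (show M ∈ _ by simp [hi, hj])] at hsum
  refine hM ((Ideal.add_mem_iff_left _ (Ideal.sum_mem _ fun U hU => ?_)).1 hsum)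
  simp only [Finset.mem_erase, Finset.mem_filter, Finset.mem_univ, true_and] at hU
  obtain ⟨hUM, hiU, hjU⟩ := hU
  by_contra hUP
  have hUsub : U.1 ⊆ M.1 := by
    rcases nested U M hUP hM ⟨i, Finset.mem_inter.2 ⟨hiU, hi⟩⟩ with h | h
    · exact h
    · exact (Finset.eq_of_subset_of_card_le h (hmax U hUP)).superset
  have hUss : U.1 ⊂ M.1 :=
    Finset.ssubset_iff_subset_ne.2 ⟨hUsub, fun e => hUM (Subtype.ext e)⟩
  have hcard := hNmax U.1 (by
    rw [Finset.mem_filter, Finset.mem_ssubsets]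
    exact ⟨hUss, .inr ⟨U, rfl, hiU, hUP⟩⟩)
  have hNU : N ⊆ U.1 := by
    rcases hN with rfl | ⟨T, rfl, hiT, hT⟩
    · simpa using hiU
    · rcases nested T U hT hUP ⟨i, Finset.mem_inter.2 ⟨hiT, hiU⟩⟩ with h | h
      · exact h
      · exact absurd (h hjU) hjN
  rw [Finset.eq_of_subset_of_card_le hNU hcard] at hjN
  exact hjN hjU

theorem X_mem_radical (n : ℕ) (S : L n) : X S ∈ (dcpIdeal n).radical := by
  rw [Ideal.radical_eq_sInf, Submodule.mem_sInf]
  exact fun P hP => X_mem_of_isPrime hP.2 hP.1 S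

theorem toSyn_single_degree_le {σ : Type*} (mo : MonomialOrder σ) {s : σ}
    (hs : ∀ t, mo.toSyn (Finsupp.single s 1) ≤ mo.toSyn (Finsupp.single t 1)) (d : σ →₀ ℕ) :
    mo.toSyn (Finsupp.single s d.degree) ≤ mo.toSyn d := by
  induction d using Finsupp.induction_linear with
  | zero => simp
  | add f g hf hg =>
    rw [map_add, Finsupp.single_add, map_add, map_add]
    exact add_le_add hf hg
  | single t k =>
    have := nsmul_le_nsmul_right (hs t) k
    rw [Finsupp.degree_single]
    rwa [← map_nsmul, ← map_nsmul, Finsupp.smul_single, Finsupp.smul_single, smul_eq_mul,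
      mul_one] at this

theorem dcp_no_quadratic_groebner (n : ℕ) (hn : 4 ≤ n) (mo : MonomialOrder (L n)) :
    ¬ ∃ G : Set (MvPolynomial (L n) ℚ),
        (∀ g ∈ G, g ∈ dcpIdeal n) ∧
        (∀ g ∈ G, g ≠ 0 ∧ g.totalDegree ≤ 2) ∧
        (∀ f ∈ dcpIdeal n, f ≠ 0 → ∃ g ∈ G, ∃ mf mg,
          IsLeadingMonomial mo f mf ∧ IsLeadingMonomial mo g mg ∧ mg ≤ mf) := by
  rintro ⟨G, hGJ, hG2, hG⟩
  have hne : Nonempty (L n) := ⟨⟨{1, 2}, by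
    rw [LFin, Finset.mem_filter, Finset.mem_powerset, Finset.insert_subset_iff,
      Finset.singleton_subset_iff, Finset.mem_Icc, Finset.mem_Icc]
    exact ⟨⟨by omega, by omega⟩, by simp⟩⟩⟩
  obtain ⟨s, hs⟩ := Finite.exists_min fun t : L n => mo.toSyn (Finsupp.single t 1)
  obtain ⟨hsV, hs2⟩ := Finset.mem_filter.1 s.2
  obtain ⟨A, B, hAB, hp⟩ := exists_isSplit_pairing_self_ne_zero (V := Finset.Icc 1 n)
    (by simpa using hn) (Finset.mem_powerset.1 hsV) hs2
  obtain ⟨k, hk⟩ := Ideal.mem_radical_iff.1 (X_mem_radical n s)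
  obtain ⟨g, hg, mf, mg, hmf, hmg, hle⟩ := hG _ hk (pow_ne_zero _ (X_ne_zero s))
  obtain rfl : mf = Finsupp.single s k := by
    simpa [X_pow_eq_monomial, support_monomial] using hmf.1
  obtain ⟨m, rfl⟩ : ∃ m, mg = Finsupp.single s m := by
    refine ⟨mg s, Finsupp.ext fun t => ?_⟩
    by_cases hts : t = s
    · simp [hts]
    · have := hle t
      rw [Finsupp.single_eq_of_ne hts] at this ⊢
      omega
  have hm2 : m ≤ 2 := by
    have := (le_totalDegree hmg.1).trans (hG2 g hg).2
    simpa using this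
  have hzero := degreeTwoFunctional_eq_zero hAB
    (Ideal.mul_mem_right (X s ^ (2 - m)) _ (hGJ g hg))
  have hlow : ∀ d ∈ g.support, d ≠ Finsupp.single s m → d.degree < m := by
    intro d hd hdm
    by_contra! hge
    refine hdm (mo.toSyn.injective (le_antisymm (hmg.2 d hd) ?_))
    exact (mo.toSyn_monotone (Finsupp.single_mono hge)).trans (toSyn_single_degree_le mo hs d)
  rw [g.as_sum, Finset.sum_mul, map_sum, Finset.sum_eq_single_of_mem _ hmg.1] at hzero
  · rw [X_pow_eq_monomial, monomial_mul, mul_one, ← Finsupp.single_add,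
      Nat.add_sub_cancel' hm2] at hzero
    have hX : monomial (Finsupp.single s 2) (coeff (Finsupp.single s m) g) =
        C (coeff (Finsupp.single s m) g) * (X s * X s) := by
      rw [← sq, X_pow_eq_monomial, C_mul_monomial, mul_one]
    rw [hX, degreeTwoFunctional_mul_X_mul_X, constantCoeff_C] at hzero
    have hc := mem_support_iff.1 hmg.1
    exact mul_ne_zero hc (mul_ne_zero two_ne_zero hp) hzero
  · intro d hd hdm
    rw [X_pow_eq_monomial, monomial_mul]
    refine degreeTwoFunctional_monomial_of_degree_lt ?_ _
    have := hlow d hd hdm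
    rw [map_add, Finsupp.degree_single]
    omega
end

section
/- Let n ≥ 4. The ℚ-algebra homomorphism U_4 → U_n induced by sending the class of Y_S to the class of Y_S for every S ∈ W_4 (note W_4 ⊆ W_n) is well defined and injective. -/
/-!
For `n ≥ 3` let `W n = {S ⊆ {1,…,n} : |S| ≥ 3}` and let `F n` be the free associative
`ℚ`-algebra on generators `Y S`, `S ∈ W n`.  Let `U n = F n / J n`, where `J n` is the
two-sided ideal generated by:
(a) `Y S * Y T + Y T * Y S` for `S ∩ T = ∅`;
(b) for each `S ⊆ {1,…,n}` with `|S| > 3`, the element `Σ (Y T₁ * Y T₂ + Y T₂ * Y T₁)`,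
    the sum over all unordered pairs `{T₁, T₂}` of distinct elements of `W n` with
    `T₁ ∩ T₂ ≠ ∅` and `T₁ ∪ T₂ = S` (equivalently, the sum of `Y T₁ * Y T₂` over all
    ordered pairs `(T₁, T₂)` of distinct elements with these properties);
(c) for each `T ⊊ S ⊆ {1,…,n}` with `|T| ≥ 3`, `|S ∖ T| > 1`, the element
    `Σ_{K ∈ W n, T ∪ K = S} (Y T * Y K + Y K * Y T)`.
`U n` is the quadratic dual of `H^•(M̄_{0,n+1}; ℚ)`, i.e. the Pontryagin ring
`H_•(Ω M̄_{0,n+1}; ℚ)`.  The quotient is realized as a `RingQuot` by the relations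
identifying each generator of `J n` with `0`.
-/

/-- Subsets of `{1,…,n}` of cardinality at least `3`, as a `Finset`. -/
def WFin (n : ℕ) : Finset (Finset ℕ) :=
  (Finset.Icc 1 n).powerset.filter fun S => 3 ≤ S.card

/-- The index type of the generators `Y S`. -/
abbrev W (n : ℕ) := {S : Finset ℕ // S ∈ WFin n}

/-- The free associative `ℚ`-algebra on the generators `Y S`, `S ∈ W n`. -/
abbrev F (n : ℕ) := FreeAlgebra ℚ (W n)

/-- The generator `Y S` of `F n`. -/
def Y {n : ℕ} (S : W n) : F n := FreeAlgebra.ι ℚ S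

/-- The generating elements of the two-sided ideal `J n`. -/
def idealGens (n : ℕ) : Set (F n) :=
  -- (a)
  {x | ∃ S T : W n, S.1 ∩ T.1 = ∅ ∧ x = Y S * Y T + Y T * Y S} ∪
  -- (b)
  {x | ∃ S : Finset ℕ, S ⊆ Finset.Icc 1 n ∧ 3 < S.card ∧
        x = ∑ p ∈ Finset.univ.filter (fun p : W n × W n =>
              p.1 ≠ p.2 ∧ (p.1.1 ∩ p.2.1).Nonempty ∧ p.1.1 ∪ p.2.1 = S),
              Y p.1 * Y p.2} ∪
  -- (c)
  {x | ∃ T : W n, ∃ S : Finset ℕ, T.1 ⊂ S ∧ S ⊆ Finset.Icc 1 n ∧ 1 < (S \ T.1).card ∧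
        x = ∑ K ∈ Finset.univ.filter (fun K : W n => T.1 ∪ K.1 = S),
              (Y T * Y K + Y K * Y T)}

/-- The relation identifying each generator of `J n` with `0`. -/
inductive URel (n : ℕ) : F n → F n → Prop
  | mk : ∀ x ∈ idealGens n, URel n x 0

/-- The quotient algebra `U n = F n / J n`. -/
abbrev U (n : ℕ) := RingQuot (URel n)

/-- The subsets of `S` of cardinality at least `3`. -/
def largeSubsets (S : Finset ℕ) : Finset (Finset ℕ) :=
  S.powerset.filter fun T => 3 ≤ T.card

lemma mem_largeSubsets {S T : Finset ℕ} : T ∈ largeSubsets S ↔ T ⊆ S ∧ 3 ≤ T.card := by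
  simp [largeSubsets]

lemma mem_WFin {n : ℕ} {T : Finset ℕ} : T ∈ WFin n ↔ T ⊆ Finset.Icc 1 n ∧ 3 ≤ T.card :=
  mem_largeSubsets

section

variable {A : Type*} [Ring A]

/-- A family of elements of `A`, indexed by finite sets, satisfies the defining relations of
`U n`.  The index sets of the sums do not mention `n`. -/
structure SatisfiesRelations (n : ℕ) (f : Finset ℕ → A) : Prop where
  disjoint : ∀ S ∈ WFin n, ∀ T ∈ WFin n, S ∩ T = ∅ → f S * f T + f T * f S = 0
  union : ∀ S ⊆ Finset.Icc 1 n, 3 < S.card →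
    ∑ p ∈ (largeSubsets S ×ˢ largeSubsets S).filter (fun p =>
      p.1 ≠ p.2 ∧ (p.1 ∩ p.2).Nonempty ∧ p.1 ∪ p.2 = S), f p.1 * f p.2 = 0
  complement : ∀ T ∈ WFin n, ∀ S ⊆ Finset.Icc 1 n, T ⊂ S → 1 < (S \ T).card →
    ∑ K ∈ (largeSubsets S).filter (fun K => T ∪ K = S), (f T * f K + f K * f T) = 0

lemma sum_pairs_eq {n : ℕ} {S : Finset ℕ} (hS : S ⊆ Finset.Icc 1 n) (f : Finset ℕ → A) :
    ∑ p ∈ Finset.univ.filter (fun p : W n × W n =>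
      p.1 ≠ p.2 ∧ (p.1.1 ∩ p.2.1).Nonempty ∧ p.1.1 ∪ p.2.1 = S), f p.1.1 * f p.2.1 =
    ∑ p ∈ (largeSubsets S ×ˢ largeSubsets S).filter (fun p =>
      p.1 ≠ p.2 ∧ (p.1 ∩ p.2).Nonempty ∧ p.1 ∪ p.2 = S), f p.1 * f p.2 := by
  refine Finset.sum_bij (fun p _ => (p.1.1, p.2.1)) ?_ ?_ ?_ ?_
  · rintro ⟨⟨T, hT⟩, ⟨K, hK⟩⟩ h
    simp only [Finset.mem_filter, Finset.mem_univ, true_and, ne_eq, Subtype.mk.injEq] at h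
    obtain ⟨hne, hi, rfl⟩ := h
    simp only [Finset.mem_filter, Finset.mem_product, mem_largeSubsets]
    exact ⟨⟨⟨Finset.subset_union_left, (mem_WFin.1 hT).2⟩,
      ⟨Finset.subset_union_right, (mem_WFin.1 hK).2⟩⟩, hne, hi, trivial⟩
  · rintro ⟨⟨T, hT⟩, ⟨K, hK⟩⟩ _ ⟨⟨T', hT'⟩, ⟨K', hK'⟩⟩ _ h
    simpa using h
  · rintro ⟨T, K⟩ h
    simp only [Finset.mem_filter, Finset.mem_product, mem_largeSubsets] at h
    obtain ⟨⟨⟨hT, hT3⟩, ⟨hK, hK3⟩⟩, hne, hi, hu⟩ := h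
    refine ⟨(⟨T, mem_WFin.2 ⟨hT.trans hS, hT3⟩⟩, ⟨K, mem_WFin.2 ⟨hK.trans hS, hK3⟩⟩), ?_, rfl⟩
    simpa using ⟨hne, hi, hu⟩
  · intros
    rfl

lemma sum_complements_eq {n : ℕ} {S : Finset ℕ} (hS : S ⊆ Finset.Icc 1 n) (T : Finset ℕ)
    (f : Finset ℕ → A) :
    ∑ K ∈ Finset.univ.filter (fun K : W n => T ∪ K.1 = S), (f T * f K.1 + f K.1 * f T) =
    ∑ K ∈ (largeSubsets S).filter (fun K => T ∪ K = S), (f T * f K + f K * f T) := by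
  refine Finset.sum_bij (fun K _ => K.1) ?_ ?_ ?_ ?_
  · rintro ⟨K, hK⟩ h
    simp only [Finset.mem_filter, Finset.mem_univ, true_and] at h
    subst h
    simp only [Finset.mem_filter, mem_largeSubsets]
    exact ⟨⟨Finset.subset_union_right, (mem_WFin.1 hK).2⟩, trivial⟩
  · rintro K _ K' _ h
    exact Subtype.ext h
  · intro K h
    simp only [Finset.mem_filter, mem_largeSubsets] at h
    obtain ⟨⟨hK, hK3⟩, hu⟩ := h
    exact ⟨⟨K, mem_WFin.2 ⟨hK.trans hS, hK3⟩⟩, by simpa using hu, rfl⟩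
  · intros
    rfl

/-- An algebra homomorphism out of `F n` that kills `idealGens n` sends the generators to a family
satisfying the defining relations, and conversely. -/
lemma satisfiesRelations_iff [Algebra ℚ A] {n : ℕ} {f : Finset ℕ → A} {g : F n →ₐ[ℚ] A}
    (hg : ∀ S : W n, g (Y S) = f S.1) :
    SatisfiesRelations n f ↔ ∀ x ∈ idealGens n, g x = 0 := by
  constructor
  · rintro h x ((⟨S, T, hST, rfl⟩ | ⟨S, hS, hS3, rfl⟩) | ⟨T, S, hTS, hS, hc, rfl⟩)
    · simpa [hg] using h.disjoint S.1 S.2 T.1 T.2 hST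
    · simp only [map_sum, map_mul, hg]
      rw [sum_pairs_eq hS, h.union S hS hS3]
    · simp only [map_sum, map_add, map_mul, hg]
      rw [sum_complements_eq hS, h.complement T.1 T.2 S hS hTS hc]
  · intro h
    refine ⟨fun S hS T hT hST => ?_, fun S hS hS3 => ?_, fun T hT S hS hTS hc => ?_⟩
    · have := h _ (Or.inl (Or.inl ⟨⟨S, hS⟩, ⟨T, hT⟩, hST, rfl⟩))
      simpa [hg] using this
    · have := h _ (Or.inl (Or.inr ⟨S, hS, hS3, rfl⟩))
      simp only [map_sum, map_mul, hg] at this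
      rwa [sum_pairs_eq hS] at this
    · have := h _ (Or.inr ⟨⟨T, hT⟩, S, hTS, hS, hc, rfl⟩)
      simp only [map_sum, map_add, map_mul, hg] at this
      rwa [sum_complements_eq hS] at this

/-- The algebra homomorphism out of `U n` determined by a family satisfying the relations. -/
lemma SatisfiesRelations.exists_algHom [Algebra ℚ A] {n : ℕ} {f : Finset ℕ → A}
    (hf : SatisfiesRelations n f) :
    ∃ φ : U n →ₐ[ℚ] A, ∀ S : W n, φ (RingQuot.mkAlgHom ℚ (URel n) (Y S)) = f S.1 := by
  let g : F n →ₐ[ℚ] A := FreeAlgebra.lift ℚ fun S : W n => f S.1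
  have hg : ∀ S : W n, g (Y S) = f S.1 := fun S => FreeAlgebra.lift_ι_apply _ _
  have hrel : ∀ ⦃x y : F n⦄, URel n x y → g x = g y := by
    rintro x _ h
    cases h with
    | mk hx => rw [(satisfiesRelations_iff hg).1 hf _ hx, map_zero]
  exact ⟨RingQuot.liftAlgHom ℚ ⟨g, hrel⟩, fun S => by
    rw [RingQuot.liftAlgHom_mkAlgHom_apply, hg]⟩

lemma SatisfiesRelations.mono {m n : ℕ} (hmn : m ≤ n) {f : Finset ℕ → A}
    (hf : SatisfiesRelations n f) : SatisfiesRelations m f := by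
  have hsub : Finset.Icc 1 m ⊆ Finset.Icc 1 n := Finset.Icc_subset_Icc_right hmn
  have hW : ∀ {S}, S ∈ WFin m → S ∈ WFin n := fun h =>
    mem_WFin.2 ⟨(mem_WFin.1 h).1.trans hsub, (mem_WFin.1 h).2⟩
  exact ⟨fun S hS T hT => hf.disjoint S (hW hS) T (hW hT),
    fun S hS => hf.union S (hS.trans hsub),
    fun T hT S hS => hf.complement T (hW hT) S (hS.trans hsub)⟩

/-- Extending a family by zero to the sets not contained in `{1,…,m}` preserves the relations. -/
lemma SatisfiesRelations.extend_zero {m : ℕ} (n : ℕ) {f : Finset ℕ → A}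
    (hf : SatisfiesRelations m f) :
    SatisfiesRelations n fun S => if S ⊆ Finset.Icc 1 m then f S else 0 := by
  refine ⟨fun S hS T hT hST => ?_, fun S hS hS3 => ?_, fun T hT S hS hTS hc => ?_⟩
  · by_cases hSm : S ⊆ Finset.Icc 1 m
    · by_cases hTm : T ⊆ Finset.Icc 1 m
      · simpa [hSm, hTm] using hf.disjoint S (mem_WFin.2 ⟨hSm, (mem_WFin.1 hS).2⟩)
          T (mem_WFin.2 ⟨hTm, (mem_WFin.1 hT).2⟩) hST
      · simp [hTm]
    · simp [hSm]
  · by_cases hSm : S ⊆ Finset.Icc 1 m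
    · rw [← hf.union S hSm hS3]
      refine Finset.sum_congr rfl fun p hp => ?_
      simp only [Finset.mem_filter, Finset.mem_product, mem_largeSubsets] at hp
      rw [if_pos (hp.1.1.1.trans hSm), if_pos (hp.1.2.1.trans hSm)]
    · refine Finset.sum_eq_zero fun p hp => ?_
      rw [← (Finset.mem_filter.1 hp).2.2.2, Finset.union_subset_iff] at hSm
      by_cases h : p.1 ⊆ Finset.Icc 1 m
      · simp [show ¬ p.2 ⊆ Finset.Icc 1 m from fun h' => hSm ⟨h, h'⟩]
      · simp [h]
  · by_cases hSm : S ⊆ Finset.Icc 1 m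
    · rw [← hf.complement T (mem_WFin.2 ⟨hTS.1.trans hSm, (mem_WFin.1 hT).2⟩) S hSm hTS hc]
      refine Finset.sum_congr rfl fun K hK => ?_
      simp only [Finset.mem_filter, mem_largeSubsets] at hK
      rw [if_pos (hTS.1.trans hSm), if_pos (hK.1.1.trans hSm)]
    · refine Finset.sum_eq_zero fun K hK => ?_
      rw [← (Finset.mem_filter.1 hK).2, Finset.union_subset_iff] at hSm
      by_cases h : T ⊆ Finset.Icc 1 m
      · simp [show ¬ K ⊆ Finset.Icc 1 m from fun h' => hSm ⟨h, h'⟩]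
      · simp [h]

end

/-- The class of `Y S` in `U n`, or `0` if `S ∉ W n`. -/
noncomputable def genClass (n : ℕ) (S : Finset ℕ) : U n :=
  if h : S ∈ WFin n then RingQuot.mkAlgHom ℚ (URel n) (Y ⟨S, h⟩) else 0

lemma genClass_coe {n : ℕ} (S : W n) : genClass n S.1 = RingQuot.mkAlgHom ℚ (URel n) (Y S) :=
  dif_pos S.2

lemma satisfiesRelations_genClass (n : ℕ) : SatisfiesRelations n (genClass n) :=
  (satisfiesRelations_iff fun S => (genClass_coe S).symm).2 fun x hx => by
    rw [RingQuot.mkAlgHom_rel ℚ (URel.mk x hx), map_zero]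

/-- for `n ≥ 4`, the `ℚ`-algebra homomorphism `U 4 → U n` induced by
sending the class of `Y S` to the class of `Y S` for every `S ∈ W 4 ⊆ W n` is well
defined and injective. -/
theorem U4_to_Un_injective (n : ℕ) (hn : 4 ≤ n) :
    ∃ φ : U 4 →ₐ[ℚ] U n,
      (∀ (S : W 4) (S' : W n), S.1 = S'.1 →
        φ (RingQuot.mkAlgHom ℚ (URel 4) (Y S)) = RingQuot.mkAlgHom ℚ (URel n) (Y S')) ∧
      Function.Injective φ := by
  obtain ⟨φ, hφ⟩ := ((satisfiesRelations_genClass n).mono hn).exists_algHom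
  obtain ⟨ψ, hψ⟩ := ((satisfiesRelations_genClass 4).extend_zero n).exists_algHom
  have hφY : ∀ (S : W 4) (S' : W n), S.1 = S'.1 →
      φ (RingQuot.mkAlgHom ℚ (URel 4) (Y S)) = RingQuot.mkAlgHom ℚ (URel n) (Y S') := by
    intro S S' h
    rw [hφ, h, genClass_coe]
  have hcomp : ψ.comp φ = AlgHom.id ℚ (U 4) := by
    refine RingQuot.ringQuot_ext' _ _ _ (FreeAlgebra.hom_ext (funext fun S => ?_))
    have hS := mem_WFin.1 S.2
    let S' : W n := ⟨S.1, mem_WFin.2 ⟨hS.1.trans (Finset.Icc_subset_Icc_right hn), hS.2⟩⟩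
    change ψ (φ (RingQuot.mkAlgHom ℚ (URel 4) (Y S))) = RingQuot.mkAlgHom ℚ (URel 4) (Y S)
    rw [hφY S S' rfl, hψ, if_pos hS.1, genClass_coe]
  exact ⟨φ, hφY, Function.LeftInverse.injective (g := ψ) fun x => DFunLike.congr_fun hcomp x⟩
end

section
/- Let n ≥ 4. For every d ≥ 0, the images in U_n of the 4^d distinct words of length d in the four generators Y_{{1,2,4}}, Y_{{1,3,4}}, Y_{{2,3,4}}, Y_{{1,2,3,4}} are linearly independent over ℚ; consequently U_n is infinite-dimensional over ℚ and its graded dimensions grow exponentially. (This is the algebraic form of the statement that the rational homotopy Lie algebra of M̄_{0,n+1} has exponential growth for n ≥ 4.) -/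
/-- The rational vector space with basis the words in four letters. -/
abbrev WordSpace := List (Fin 4) →₀ ℚ

/-- The operator prepending the letter `i` to each word. -/
noncomputable def prependLetter (i : Fin 4) : Module.End ℚ WordSpace :=
  Finsupp.lmapDomain ℚ ℚ (List.cons i)

@[simp]
lemma prependLetter_single (i : Fin 4) (w : List (Fin 4)) (a : ℚ) :
    prependLetter i (Finsupp.single w a) = Finsupp.single (i :: w) a := by
  simp [prependLetter]

/-- The values on words of the operator `correction`: it kills every word that does not begin
with the letter `3`, and its value on the words `3 :: w` is dictated by the relation
`sum_offDiag_wordOp`. -/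
noncomputable def correctionWord : List (Fin 4) → WordSpace
  | [] => 0
  | i :: w =>
    if i = 3 then
      -(∑ j, prependLetter j (correctionWord w) +
        ∑ p ∈ (Finset.univ : Finset (Fin 4)).offDiag, Finsupp.single (p.1 :: p.2 :: w) 1)
    else 0

/-- The operator on the word space by which the fifth generator `Y {1,2,3}` acts. -/
noncomputable def correction : Module.End ℚ WordSpace :=
  Finsupp.linearCombination ℚ correctionWord

@[simp]
lemma correction_single (w : List (Fin 4)) :
    correction (Finsupp.single w 1) = correctionWord w := by
  simp [correction]

/-- The five operators on the word space: the four prepending operators and `correction`. -/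
noncomputable def wordOp : Fin 5 → Module.End ℚ WordSpace :=
  Fin.snoc (α := fun _ => Module.End ℚ WordSpace) prependLetter correction

@[simp]
lemma wordOp_castSucc (i : Fin 4) : wordOp i.castSucc = prependLetter i := by
  simp only [wordOp, Fin.snoc_castSucc]

@[simp]
lemma wordOp_last : wordOp (Fin.last 4) = correction := by
  simp only [wordOp, Fin.snoc_last]

lemma sum_offDiag_wordOp :
    ∑ p ∈ (Finset.univ : Finset (Fin 5)).offDiag, wordOp p.1 * wordOp p.2 = 0 := by
  have hsplit : (Finset.univ : Finset (Fin 5)).offDiag =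
      Finset.univ.filter fun p : Fin 5 × Fin 5 => p.1 ≠ p.2 := by decide
  have hsplit' : (Finset.univ : Finset (Fin 4)).offDiag =
      Finset.univ.filter fun p : Fin 4 × Fin 4 => p.1 ≠ p.2 := by decide
  refine Finsupp.lhom_ext' fun w => LinearMap.ext_ring ?_
  have hcorr : ∑ i : Fin 4, correctionWord (i :: w) = correctionWord (3 :: w) := by
    rw [Fin.sum_univ_four]
    simp [correctionWord]
  have hthree : correctionWord (3 :: w) = -(∑ j, prependLetter j (correctionWord w) +
      ∑ i : Fin 4, ∑ j : Fin 4, if i ≠ j then Finsupp.single (i :: j :: w) 1 else 0) := by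
    rw [correctionWord, if_pos rfl, hsplit', Finset.sum_filter, Fintype.sum_prod_type]
  rw [hsplit, Finset.sum_filter, Fintype.sum_prod_type]
  simp only [Fin.sum_univ_castSucc (n := 4), wordOp_castSucc, wordOp_last]
  simp only [ne_eq, Fin.castSucc_inj, Fin.castSucc_ne_last, (Fin.castSucc_ne_last _).symm,
    not_false_eq_true, not_true_eq_false, if_true, if_false, add_zero,
    Finset.sum_add_distrib, LinearMap.comp_apply, LinearMap.add_apply, LinearMap.sum_apply,
    Module.End.mul_apply, Finsupp.lsingle_apply, correction_single, prependLetter_single, hcorr,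
    hthree, LinearMap.zero_apply, ite_not, apply_ite (fun φ : Module.End ℚ WordSpace =>
      φ (Finsupp.single w 1))]
  abel

/-- The subsets of `{1,2,3,4}` with at least three elements. -/
def smallSet : Fin 5 → Finset ℕ :=
  ![{1, 2, 4}, {1, 3, 4}, {2, 3, 4}, {1, 2, 3, 4}, {1, 2, 3}]

lemma smallSet_injective : Function.Injective smallSet := by
  decide

lemma smallSet_mem_WFin {n : ℕ} (hn : 4 ≤ n) (i : Fin 5) : smallSet i ∈ WFin n := by
  have hsub : ∀ i, smallSet i ⊆ Finset.Icc 1 4 := by decide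
  have hcard : ∀ i, 3 ≤ (smallSet i).card := by decide
  exact Finset.mem_filter.2 ⟨Finset.mem_powerset.2
    ((hsub i).trans (Finset.Icc_subset_Icc_right hn)), hcard i⟩

lemma smallSet_union : ∀ i j, i ≠ j → smallSet i ∪ smallSet j = {1, 2, 3, 4} := by
  decide

lemma smallSet_inter_nonempty : ∀ i j, (smallSet i ∩ smallSet j).Nonempty := by
  decide

lemma card_smallSet_union_sdiff_le :
    ∀ i j, ((smallSet i ∪ smallSet j) \ smallSet i).card ≤ 1 := by
  decide

/-- The operator by which the generator `Y S` acts on the word space; it is `0` unless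
`S ⊆ {1,2,3,4}`. -/
noncomputable def genOp (S : Finset ℕ) : Module.End ℚ WordSpace :=
  ∑ i, if S = smallSet i then wordOp i else 0

@[simp]
lemma genOp_smallSet (i : Fin 5) : genOp (smallSet i) = wordOp i := by
  simp [genOp, smallSet_injective.eq_iff]

lemma exists_smallSet_of_genOp_ne_zero {S : Finset ℕ} (hS : genOp S ≠ 0) :
    ∃ i, S = smallSet i := by
  obtain ⟨i, -, hi⟩ := Finset.exists_ne_zero_of_sum_ne_zero hS
  exact ⟨i, by by_contra h; simp [h] at hi⟩

lemma exists_smallSet_of_genOp_mul_ne_zero {S T : Finset ℕ} (h : genOp S * genOp T ≠ 0) :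
    ∃ i j, S = smallSet i ∧ T = smallSet j := by
  obtain ⟨i, hi⟩ := exists_smallSet_of_genOp_ne_zero (left_ne_zero_of_mul h)
  obtain ⟨j, hj⟩ := exists_smallSet_of_genOp_ne_zero (right_ne_zero_of_mul h)
  exact ⟨i, j, hi, hj⟩

/-- The representation of the free algebra on the word space. -/
noncomputable def freeAction (n : ℕ) : F n →ₐ[ℚ] Module.End ℚ WordSpace :=
  FreeAlgebra.lift ℚ fun S : W n => genOp S.1

@[simp]
lemma freeAction_Y {n : ℕ} (S : W n) : freeAction n (Y S) = genOp S.1 := by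
  simp [freeAction, Y]

lemma sum_genOp_mul_genOp {n : ℕ} (hn : 4 ≤ n) (S : Finset ℕ) :
    ∑ p ∈ Finset.univ.filter (fun p : W n × W n =>
      p.1 ≠ p.2 ∧ (p.1.1 ∩ p.2.1).Nonempty ∧ p.1.1 ∪ p.2.1 = S),
      genOp p.1.1 * genOp p.2.1 = 0 := by
  by_cases hS : S = {1, 2, 3, 4}
  · subst hS
    rw [← sum_offDiag_wordOp]
    symm
    refine Finset.sum_of_injOn
      (fun p : Fin 5 × Fin 5 => ((⟨smallSet p.1, smallSet_mem_WFin hn p.1⟩ : W n),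
        (⟨smallSet p.2, smallSet_mem_WFin hn p.2⟩ : W n))) ?_ ?_ ?_ ?_
    · rintro ⟨i, j⟩ - ⟨k, l⟩ - h
      simpa [smallSet_injective.eq_iff] using h
    · rintro ⟨i, j⟩ h
      have hij : i ≠ j := by simpa using h
      simpa [smallSet_injective.eq_iff, hij, smallSet_union i j hij] using
        smallSet_inter_nonempty i j
    · rintro ⟨⟨A, hA⟩, ⟨B, hB⟩⟩ h hnot
      by_contra hne
      obtain ⟨i, j, rfl, rfl⟩ := exists_smallSet_of_genOp_mul_ne_zero hne
      have hij : i ≠ j := by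
        rintro rfl
        simp at h
      exact hnot ⟨(i, j), by simpa using hij, rfl⟩
    · rintro ⟨i, j⟩ -
      simp
  · refine Finset.sum_eq_zero ?_
    rintro ⟨⟨A, hA⟩, ⟨B, hB⟩⟩ h
    by_contra hne
    obtain ⟨i, j, rfl, rfl⟩ := exists_smallSet_of_genOp_mul_ne_zero hne
    obtain ⟨hij, -, hU⟩ := (Finset.mem_filter.1 h).2
    refine hS (hU.symm.trans (smallSet_union i j ?_))
    rintro rfl
    exact hij rfl

lemma freeAction_idealGens {n : ℕ} (hn : 4 ≤ n) {x : F n} (hx : x ∈ idealGens n) :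
    freeAction n x = 0 := by
  rcases hx with (⟨S, T, hST, rfl⟩ | ⟨S, -, -, rfl⟩) | ⟨T, S, -, -, hcard, rfl⟩
  · have key : ∀ A B : Finset ℕ, A ∩ B = ∅ → genOp A * genOp B = 0 := by
      intro A B hAB
      by_contra hne
      obtain ⟨i, j, rfl, rfl⟩ := exists_smallSet_of_genOp_mul_ne_zero hne
      exact (smallSet_inter_nonempty i j).ne_empty hAB
    simp [key _ _ hST, key _ _ ((Finset.inter_comm _ _).trans hST)]
  · simpa using sum_genOp_mul_genOp hn S
  · rw [map_sum]
    refine Finset.sum_eq_zero fun K hK => ?_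
    obtain rfl := (Finset.mem_filter.1 hK).2
    have key : genOp T.1 = 0 ∨ genOp K.1 = 0 := by
      by_contra! hne
      obtain ⟨i, hi⟩ := exists_smallSet_of_genOp_ne_zero hne.1
      obtain ⟨j, hj⟩ := exists_smallSet_of_genOp_ne_zero hne.2
      rw [hi, hj] at hcard
      exact hcard.not_ge (card_smallSet_union_sdiff_le i j)
    rcases key with h | h <;> simp [h]

/-- The representation of `U n` on the word space. -/
noncomputable def wordAction {n : ℕ} (hn : 4 ≤ n) : U n →ₐ[ℚ] Module.End ℚ WordSpace :=
  RingQuot.liftAlgHom ℚ ⟨freeAction n, by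
    rintro _ _ ⟨hx⟩
    rw [freeAction_idealGens hn hx, map_zero]⟩

@[simp]
lemma wordAction_mkAlgHom {n : ℕ} (hn : 4 ≤ n) (x : F n) :
    wordAction hn (RingQuot.mkAlgHom ℚ (URel n) x) = freeAction n x := by
  simp [wordAction]

lemma freeAction_prod_single_nil {n : ℕ} {g : Fin 4 → W n}
    (hg : ∀ i, (g i).1 = smallSet i.castSucc) (l : List (Fin 4)) :
    freeAction n (l.map fun i => Y (g i)).prod (Finsupp.single [] 1) = Finsupp.single l 1 := by
  induction l with
  | nil => simp
  | cons i l ih => simp [ih, hg]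

lemma not_finite_of_linearIndependent_words {K A : Type*} [DivisionRing K] [AddCommGroup A]
    [Module K A] {v : ∀ d : ℕ, (Fin d → Fin 4) → A} (hv : ∀ d, LinearIndependent K (v d)) :
    ¬ Module.Finite K A := by
  intro _
  have hle := (hv (Module.finrank K A)).fintype_card_le_finrank
  rw [Fintype.card_fun, Fintype.card_fin, Fintype.card_fin] at hle
  exact hle.not_gt (Nat.lt_pow_self (by norm_num))

/-- for `n ≥ 4` and every `d ≥ 0`, the images in `U n` of the `4^d`
distinct words of length `d` in the four generators `Y {1,2,4}`, `Y {1,3,4}`,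
`Y {2,3,4}`, `Y {1,2,3,4}` are linearly independent over `ℚ`; consequently `U n` is
infinite-dimensional over `ℚ` (and its graded dimensions grow exponentially). -/
theorem words_linearIndependent_Un (n : ℕ) (hn : 4 ≤ n) (g : Fin 4 → W n)
    (h0 : (g 0).1 = {1, 2, 4}) (h1 : (g 1).1 = {1, 3, 4})
    (h2 : (g 2).1 = {2, 3, 4}) (h3 : (g 3).1 = {1, 2, 3, 4}) :
    (∀ d : ℕ, LinearIndependent ℚ
      (fun w : Fin d → Fin 4 =>
        RingQuot.mkAlgHom ℚ (URel n) ((List.ofFn fun i => Y (g (w i))).prod))) ∧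
    ¬ Module.Finite ℚ (U n) := by
  have hg : ∀ i, (g i).1 = smallSet i.castSucc := by
    intro i
    fin_cases i
    exacts [h0, h1, h2, h3]
  have hind : ∀ d : ℕ, LinearIndependent ℚ (fun w : Fin d → Fin 4 =>
      RingQuot.mkAlgHom ℚ (URel n) ((List.ofFn fun i => Y (g (w i))).prod)) := by
    intro d
    refine LinearIndependent.of_comp ((LinearMap.applyₗ (Finsupp.single [] 1 : WordSpace)).comp
      (wordAction hn).toLinearMap) ?_
    convert (Finsupp.basisSingleOne (R := ℚ) (ι := List (Fin 4))).linearIndependent.comp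
      (List.ofFn (n := d)) List.ofFn_injective using 1
    funext w
    have hw := freeAction_prod_single_nil hg (List.ofFn w)
    rw [List.map_ofFn] at hw
    simpa [Function.comp_def] using hw
  exact ⟨hind, not_finite_of_linearIndependent_words hind⟩
end
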